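/- (Lewko) For every ε > 0 there exist constants C_ε > 0 and c > 0 such that the following holds. Let p be a prime with p ≡ 3 (mod 4) and let E ⊆ F_p² with |E| ≤ c·p^{26/21}. Then □(E) ≤ C_ε·p^{ε}·|E|^{99/41}. -/

import Mathlib

open Finset

namespace FpDist

/-- Points of `𝔽_p²`. -/
abbrev Pt (p : ℕ) := ZMod p × ZMod p

/-- The "distance" `‖x - y‖ = (x₁-y₁)² + (x₂-y₂)²` in `𝔽_p²`. -/
def dist2 {p : ℕ} (x y : Pt p) : ZMod p := (x.1 - y.1)^2 + (x.2 - y.2)^2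

/-- `‖x‖ = x₁² + x₂²`. -/
def norm2 {p : ℕ} (x : Pt p) : ZMod p := x.1^2 + x.2^2

/-- The distance set `Δ(E) = {‖x - y‖ : x, y ∈ E}`. -/
def distSet {p : ℕ} (E : Finset (Pt p)) : Finset (ZMod p) :=
  (E ×ˢ E).image fun q => dist2 q.1 q.2

/-- `(a, b, c)` is a corner if `(b - a) · (c - a) = 0`. -/
def IsCorner {p : ℕ} (a b c : Pt p) : Prop :=
  (b.1 - a.1) * (c.1 - a.1) + (b.2 - a.2) * (c.2 - a.2) = 0

/-- `(a, b, c, d)` forms a rectangle if `(a,b,d), (b,a,c), (c,b,d), (d,a,c)` are corners. -/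
def IsRectangle {p : ℕ} (a b c d : Pt p) : Prop :=
  IsCorner a b d ∧ IsCorner b a c ∧ IsCorner c b d ∧ IsCorner d a c

/-- `□(E)`: the number of non-degenerate rectangles `(a,b,c,d) ∈ E⁴`
(non-degenerate: not all four vertices lie on one line). -/
noncomputable def rectCount (p : ℕ) [Fact p.Prime] (E : Finset (Pt p)) : ℕ :=
  Set.ncard {q : Pt p × Pt p × Pt p × Pt p |
    q.1 ∈ E ∧ q.2.1 ∈ E ∧ q.2.2.1 ∈ E ∧ q.2.2.2 ∈ E ∧
    IsRectangle q.1 q.2.1 q.2.2.1 q.2.2.2 ∧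
    ¬ Collinear (ZMod p) ({q.1, q.2.1, q.2.2.1, q.2.2.2} : Set (Pt p))}

/-- `T(E)`: the number of isosceles triangles, i.e. triples `(a,b,c) ∈ E³`
with `‖a - c‖ = ‖b - c‖ ≠ 0`. -/
def triCount {p : ℕ} (E : Finset (Pt p)) : ℕ :=
  ((E ×ˢ E ×ˢ E).filter fun q =>
    dist2 q.1 q.2.2 = dist2 q.2.1 q.2.2 ∧ dist2 q.1 q.2.2 ≠ 0).card

open MvPolynomial in
/-- The space of polynomials of degree at most `D` in three variables has dimension
`(D + 3).choose 3`. -/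
theorem six_mul_finrank_restrictTotalDegree (K : Type*) [Field K] (D : ℕ) :
    6 * Module.finrank K (restrictTotalDegree (Fin 3) K D) = (D + 1) * (D + 2) * (D + 3) := by
  rw [restrictTotalDegree, Module.finrank_eq_nat_card_basis (basisRestrictSupport K _)]
  have e : {n : Fin 3 →₀ ℕ | (n.sum fun _ e => e) ≤ D} ≃
      ((Finset.range (D+1)).sigma fun a => (Finset.range (D+1-a)).sigma fun b => Finset.range (D+1-a-b) : Finset (Σ _ : ℕ, Σ _ : ℕ, ℕ)) := 
    { toFun := fun n => ⟨⟨n.1 0, n.1 1, n.1 2⟩, by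
        have h : (n.1.sum fun _ e => e) ≤ D := n.2
        rw [Finsupp.sum_fintype _ _ (fun _ => rfl), Fin.sum_univ_three] at h
        simp only [Finset.mem_sigma, Finset.mem_range]
        omega⟩
      invFun := fun s => ⟨Finsupp.equivFunOnFinite.symm ![s.1.1, s.1.2.1, s.1.2.2], by
        have := s.2
        simp only [Finset.mem_sigma, Finset.mem_range] at this
        change (Finsupp.sum _ fun _ e => e) ≤ D
        rw [Finsupp.sum_fintype _ _ (fun _ => rfl), Fin.sum_univ_three]
        simp
        omega⟩
      left_inv := fun n => by
        ext i; fin_cases i <;> simp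
      right_inv := fun s => by
        ext <;> simp }
  rw [Nat.card_congr e, Nat.card_eq_fintype_card, Fintype.card_coe]
  simp only [Finset.card_sigma, Finset.card_range]
  have h1 : ∀ n : ℕ, 2 * ∑ b ∈ Finset.range n, (n - b) = n * (n + 1) := by
    intro n
    induction n with
    | zero => simp
    | succ n ih =>
      rw [Finset.sum_range_succ']
      simp only [Nat.add_sub_add_right]
      rw [mul_add, ih]; simp; ring
  have h2 : ∀ n : ℕ, 6 * ∑ a ∈ Finset.range n, ∑ b ∈ Finset.range (n - a), (n - a - b) = n * (n + 1) * (n + 2) := by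
    intro n
    induction n with
    | zero => simp
    | succ n ih =>
      rw [Finset.sum_range_succ']
      simp only [Nat.add_sub_add_right]
      rw [mul_add, ih]
      have := h1 (n+1)
      simp only [Nat.sub_zero]
      linear_combination 3 * this
  exact h2 (D+1)

section NullLines
variable {K : Type*} [Field K]

/-- The restriction of a polynomial in three variables to the null line
`z = v + m x`, `y = w + m z` with parameters `q = (m, v, w)`, parametrised by `x`. -/
noncomputable def lineRes (q : K × K × K) : MvPolynomial (Fin 3) K →ₐ[K] Polynomial K :=
  MvPolynomial.aeval ![Polynomial.X,
    Polynomial.C (q.2.2 + q.1 * q.2.1) + Polynomial.C (q.1 ^ 2) * Polynomial.X,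
    Polynomial.C q.2.1 + Polynomial.C q.1 * Polynomial.X]

theorem lineRes_X0 (q : K × K × K) : lineRes q (MvPolynomial.X 0) = Polynomial.X := by
  simp [lineRes]

theorem lineRes_X1 (q : K × K × K) : lineRes q (MvPolynomial.X 1) =
    Polynomial.C (q.2.2 + q.1 * q.2.1) + Polynomial.C (q.1 ^ 2) * Polynomial.X := by
  simp [lineRes]

theorem lineRes_X2 (q : K × K × K) : lineRes q (MvPolynomial.X 2) =
    Polynomial.C q.2.1 + Polynomial.C q.1 * Polynomial.X := by
  simp [lineRes]

theorem lineRes_C (q : K × K × K) (c : K) : lineRes q (MvPolynomial.C c) = Polynomial.C c := by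
  simp [lineRes]

theorem natDegree_lineRes_le (q : K × K × K) (f : MvPolynomial (Fin 3) K) :
    (lineRes q f).natDegree ≤ f.totalDegree := by
  have := MvPolynomial.aeval_natDegree_le (n := 1) f le_rfl ![Polynomial.X,
    Polynomial.C (q.2.2 + q.1 * q.2.1) + Polynomial.C (q.1 ^ 2) * Polynomial.X,
    Polynomial.C q.2.1 + Polynomial.C q.1 * Polynomial.X] (by
      intro i
      fin_cases i
      · simp
      · simp only [Fin.mk_one, Matrix.cons_val_one, Matrix.cons_val_zero]
        compute_degree
      · simp only [Fin.reduceFinMk, Matrix.cons_val]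
        compute_degree)
  rw [mul_one] at this
  exact this

open MvPolynomial in
/-- Distinct null lines are separated by a linear form. -/
theorem exists_linear_form_separating {q r : K × K × K} (h : q ≠ r) :
    ∃ L : MvPolynomial (Fin 3) K, L.totalDegree ≤ 1 ∧ lineRes r L = 0 ∧ lineRes q L ≠ 0 := by
  have hX : ∀ (i j : Fin 3) (a b : K), (X i - C a - C b * X j :
      MvPolynomial (Fin 3) K).totalDegree ≤ 1 := by
    intro i j a b
    refine (totalDegree_sub _ _).trans (max_le ((totalDegree_sub _ _).trans (max_le ?_ ?_)) ?_)
    · simp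
    · simp
    · exact (totalDegree_mul _ _).trans (by simp)
  obtain ⟨m, v, w⟩ := q
  obtain ⟨m', v', w'⟩ := r
  by_cases h1 : lineRes (m, v, w) (X 2 - C v' - C m' * X 0) = 0
  · refine ⟨X 1 - C w' - C m' * X 2, hX _ _ _ _, ?_, ?_⟩
    · simp only [map_sub, map_mul, lineRes_X1, lineRes_X2, lineRes_C]
      simp only [map_add, map_mul, map_pow]; ring
    · simp only [map_sub, map_mul, lineRes_X0, lineRes_X1, lineRes_X2, lineRes_C] at h1 ⊢
      have hm : m = m' := by
        have := congrArg (fun f => Polynomial.coeff f 1) h1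
        simpa [sub_eq_zero] using this
      have hv : v = v' := by
        have := congrArg (fun f => Polynomial.coeff f 0) h1
        simpa [sub_eq_zero] using this
      subst hm hv
      have hw : w ≠ w' := fun hw => h (by rw [hw])
      intro h0
      have := congrArg (fun f => Polynomial.coeff f 0) h0
      simp at this
      exact hw (by linear_combination this)
  · refine ⟨X 2 - C v' - C m' * X 0, hX _ _ _ _, ?_, h1⟩
    simp only [map_sub, map_mul, lineRes_X0, lineRes_X2, lineRes_C]
    ring

open MvPolynomial in
/-- Bezout's inequality for null lines: an irreducible polynomial `g` not dividing `U` shares at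
most `deg g * deg U` null lines with it. -/
theorem card_common_lines_le {g U : MvPolynomial (Fin 3) K} (hg : Irreducible g) (hU : ¬ g ∣ U)
    (S : Finset (K × K × K)) (hS : ∀ q ∈ S, lineRes q g = 0 ∧ lineRes q U = 0) :
    S.card ≤ g.totalDegree * U.totalDegree := by
  classical
  by_contra! hlt
  have hg0 : g ≠ 0 := hg.ne_zero
  have hU0 : U ≠ 0 := fun h => hU (h ▸ dvd_zero _)
  obtain ⟨e, he⟩ : ∃ e, g.totalDegree = e := ⟨_, rfl⟩
  obtain ⟨u, hu⟩ : ∃ u, U.totalDegree = u := ⟨_, rfl⟩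
  obtain ⟨M, hM⟩ : ∃ M, S.card = M := ⟨_, rfl⟩
  rw [he, hu, hM] at hlt
  obtain ⟨D, hD⟩ : ∃ D, D = M ^ 2 + 2 * e * u + 1 + e + u := ⟨_, rfl⟩
  have hMD : M < D := by
    have h1 := Nat.le_self_pow two_ne_zero M
    have h2 : 0 ≤ 2 * e * u := Nat.zero_le _
    omega
  have hsep : ∀ q r : K × K × K, q ≠ r → ∃ L : MvPolynomial (Fin 3) K,
      L.totalDegree ≤ 1 ∧ lineRes r L = 0 ∧ lineRes q L ≠ 0 :=
    fun q r h => exists_linear_form_separating h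
  choose! L hL using hsep
  let P : S → MvPolynomial (Fin 3) K := fun i => ∏ j ∈ S.erase i.1, L i.1 j
  have hP : ∀ i, (P i).totalDegree ≤ M - 1 := by
    intro i
    refine (totalDegree_finsetProd _ _).trans ((Finset.sum_le_card_nsmul _ _ 1 ?_).trans ?_)
    · intro j hj
      exact (hL _ _ (Finset.ne_of_mem_erase hj).symm).1
    · rw [Finset.card_erase_of_mem i.2, hM]; simp
  have hPi : ∀ i, lineRes i.1 (P i) ≠ 0 := by
    intro i
    simp only [P, map_prod]
    rw [Finset.prod_ne_zero_iff]
    intro j hj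
    exact (hL _ _ (Finset.ne_of_mem_erase hj).symm).2.2
  have hPj : ∀ i j, i ≠ j → lineRes j.1 (P i) = 0 := by
    intro i j hij
    simp only [P, map_prod]
    have hj : j.1 ≠ i.1 := fun h => hij (Subtype.ext h.symm)
    exact Finset.prod_eq_zero (Finset.mem_erase.2 ⟨hj, j.2⟩) (hL _ _ hj.symm).2.1
  let V := restrictTotalDegree (Fin 3) K
  let ι : Polynomial K →ₐ[K] MvPolynomial (Fin 3) K := Polynomial.aeval (X 0)
  have hι : ∀ q c, lineRes q (ι c) = c := by
    intro q c
    have : (lineRes q).comp ι = AlgHom.id K _ := by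
      ext; simp [ι, lineRes_X0]
    exact DFunLike.congr_fun this c
  have hιdeg : ∀ c, (ι c).totalDegree ≤ c.natDegree := by
    intro c
    simp only [ι, Polynomial.aeval_eq_sum_range]
    refine (totalDegree_finsetSum _ _).trans (Finset.sup_le ?_)
    intro i hi
    refine (totalDegree_smul_le _ _).trans ((totalDegree_pow _ _).trans ?_)
    simp at hi ⊢
    omega
  let Φ : ((V (D - e)) × (V (D - u))) × (S → Polynomial.degreeLT K (D - M)) →ₗ[K]
      MvPolynomial (Fin 3) K :=
    LinearMap.coprod (LinearMap.coprod ((LinearMap.mulLeft K g).comp (V (D - e)).subtype)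
      ((LinearMap.mulLeft K U).comp (V (D - u)).subtype))
      (∑ i, (LinearMap.mulLeft K (P i)).comp (ι.toLinearMap.comp
        ((Polynomial.degreeLT K (D - M)).subtype.comp (LinearMap.proj i))))
  have hΦ : ∀ x, Φ x = g * x.1.1 + U * x.1.2 + ∑ i, P i * ι (x.2 i) := by
    intro x
    simp [Φ]
  have hrange : LinearMap.range Φ ≤ V D := by
    rintro _ ⟨x, rfl⟩
    rw [hΦ]
    refine (V D).add_mem ((V D).add_mem ?_ ?_) ((V D).sum_mem ?_)
    · have := (mem_restrictTotalDegree _ _ _).1 x.1.1.2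
      exact (mem_restrictTotalDegree _ _ _).2 ((totalDegree_mul _ _).trans (by omega))
    · have := (mem_restrictTotalDegree _ _ _).1 x.1.2.2
      exact (mem_restrictTotalDegree _ _ _).2 ((totalDegree_mul _ _).trans (by omega))
    · intro i _
      have h1 := hP i
      have h2 := hιdeg (x.2 i)
      have h3 : (x.2 i : Polynomial K).natDegree < D - M := by
        rcases eq_or_ne (x.2 i : Polynomial K) 0 with h | h
        · rw [h]; simp; omega
        · rw [Polynomial.natDegree_lt_iff_degree_lt h]
          exact Polynomial.mem_degreeLT.1 (x.2 i).2
      exact (mem_restrictTotalDegree _ _ _).2 ((totalDegree_mul _ _).trans (by omega))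
  let Ψ : V (D - e - u) →ₗ[K] MvPolynomial (Fin 3) K × MvPolynomial (Fin 3) K :=
    LinearMap.prod ((LinearMap.mulLeft K U).comp (V (D - e - u)).subtype)
      (-(LinearMap.mulLeft K g).comp (V (D - e - u)).subtype)
  let Θ : ((V (D - e)) × (V (D - u))) × (S → Polynomial.degreeLT K (D - M)) →ₗ[K]
      MvPolynomial (Fin 3) K × MvPolynomial (Fin 3) K :=
    (LinearMap.prodMap (V (D - e)).subtype (V (D - u)).subtype).comp (LinearMap.fst K _ _)
  have hker0 : ∀ x, Φ x = 0 → x.2 = 0 := by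
    intro x hx
    funext i
    rw [hΦ] at hx
    have h := congrArg (lineRes i.1) hx
    simp only [map_add, map_mul, (hS i.1 i.2).1, (hS i.1 i.2).2, zero_mul, zero_add, map_sum,
      map_zero, hι] at h
    rw [Finset.sum_eq_single i (fun j _ hj => by rw [hPj j i hj, zero_mul]) (by simp)] at h
    exact Subtype.ext ((mul_eq_zero.1 h).resolve_left (hPi i))
  have hker1 : ∀ x, Φ x = 0 → Θ x ∈ LinearMap.range Ψ := by
    intro x hx
    have h2 := hker0 x hx
    rw [hΦ, h2] at hx
    simp only [Pi.zero_apply, ZeroMemClass.coe_zero, map_zero, mul_zero, Finset.sum_const_zero,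
      add_zero] at hx
    have hdvd : g ∣ (x.1.2 : MvPolynomial (Fin 3) K) := by
      have : g ∣ U * x.1.2 := ⟨-x.1.1, by linear_combination hx⟩
      exact (hg.prime.dvd_or_dvd this).resolve_left hU
    obtain ⟨c, hc⟩ := hdvd
    have hc1 : (x.1.1 : MvPolynomial (Fin 3) K) = - (U * c) := by
      apply mul_left_cancel₀ hg0
      rw [hc] at hx
      linear_combination hx
    have hcd : c.totalDegree ≤ D - e - u := by
      rcases eq_or_ne c 0 with h | h
      · simp [h]
      · have h3 := (mem_restrictTotalDegree _ _ _).1 x.1.2.2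
        rw [hc, totalDegree_mul_of_isDomain hg0 h] at h3
        omega
    refine ⟨⟨-c, (mem_restrictTotalDegree _ _ _).2 (by rwa [totalDegree_neg])⟩, ?_⟩
    simp [Ψ, Θ, hc, hc1]
  have hkerfin : Module.finrank K (LinearMap.ker Φ) ≤ Module.finrank K (V (D - e - u)) := by
    refine le_trans ?_ (LinearMap.finrank_range_le Ψ)
    refine LinearMap.finrank_le_finrank_of_injective
      (f := (Θ.comp (LinearMap.ker Φ).subtype).codRestrict (LinearMap.range Ψ)
        (fun x => hker1 x.1 (LinearMap.mem_ker.1 x.2))) ?_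
    refine (injective_iff_map_eq_zero _).2 fun x hx => ?_
    have h2 := hker0 x.1 (LinearMap.mem_ker.1 x.2)
    have h1 : Θ x.1 = 0 := congrArg Subtype.val hx
    apply Subtype.ext
    refine Prod.ext (Prod.ext ?_ ?_) h2
    · exact Subtype.ext (congrArg Prod.fst h1)
    · exact Subtype.ext (congrArg Prod.snd h1)
  have hrn := LinearMap.finrank_range_add_finrank_ker Φ
  have hr : Module.finrank K (LinearMap.range Φ) ≤ Module.finrank K (V D) :=
    Submodule.finrank_mono hrange
  have hdeg : Module.finrank K (Polynomial.degreeLT K (D - M)) = D - M := by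
    rw [(Polynomial.degreeLTEquiv K (D - M)).finrank_eq]; simp
  have : Module.Finite K (Polynomial.degreeLT K (D - M)) :=
    Module.Finite.equiv (Polynomial.degreeLTEquiv K (D - M)).symm
  rw [Module.finrank_prod, Module.finrank_prod, Module.finrank_pi_fintype, Finset.sum_const,
    hdeg] at hrn
  simp only [Finset.card_univ, Fintype.card_coe, hM, smul_eq_mul] at hrn
  have v1 := six_mul_finrank_restrictTotalDegree K D
  have v2 := six_mul_finrank_restrictTotalDegree K (D - e)
  have v3 := six_mul_finrank_restrictTotalDegree K (D - u)
  have v4 := six_mul_finrank_restrictTotalDegree K (D - e - u)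
  have key : 6 * (Module.finrank K (V (D - e)) + Module.finrank K (V (D - u)) + M * (D - M))
      ≤ 6 * (Module.finrank K (V D) + Module.finrank K (V (D - e - u))) := by omega
  simp only [mul_add] at key
  rw [v1, v2, v3, v4] at key
  have d2 : ((D - e : ℕ) : ℤ) = D - e := by omega
  have d3 : ((D - u : ℕ) : ℤ) = D - u := by omega
  have d4 : ((D - e - u : ℕ) : ℤ) = D - e - u := by omega
  have d5 : ((D - M : ℕ) : ℤ) = D - M := by omega
  zify at key hlt hD
  rw [d2, d3, d4, d5] at key
  have hpos : (0 : ℤ) ≤ (e : ℤ) * u := by positivity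
  have hpos2 : (0 : ℤ) ≤ (e : ℤ) * u * (e + u) := by positivity
  have hDM : (D : ℤ) * 1 ≤ D * (M - e * u) :=
    mul_le_mul_of_nonneg_left (by linarith) (by positivity)
  nlinarith [key, hDM, hpos, hpos2, hD]

open MvPolynomial in
/-- Few null lines lie on a surface of small degree. -/
theorem exists_polynomial_vanishing_on_lines (S : Finset (K × K × K)) :
    ∃ f : MvPolynomial (Fin 3) K, f ≠ 0 ∧ f.totalDegree ≤ Nat.sqrt (6 * S.card) ∧
      ∀ q ∈ S, lineRes q f = 0 := by
  obtain ⟨D, hD⟩ : ∃ D, D = Nat.sqrt (6 * S.card) := ⟨_, rfl⟩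
  let Φ : restrictTotalDegree (Fin 3) K D →ₗ[K] (S → Polynomial.degreeLT K (D + 1)) :=
    LinearMap.pi fun q => ((lineRes q.1).toLinearMap.comp
      (restrictTotalDegree (Fin 3) K D).subtype).codRestrict _ (fun f => by
        have h1 := natDegree_lineRes_le q.1 f.1
        have h2 := (mem_restrictTotalDegree _ _ _).1 f.2
        refine Polynomial.mem_degreeLT.2 ((Polynomial.degree_le_natDegree).trans_lt ?_)
        exact_mod_cast Nat.lt_succ_of_le (h1.trans h2))
  have hfin : Module.finrank K (S → Polynomial.degreeLT K (D + 1)) <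
      Module.finrank K (restrictTotalDegree (Fin 3) K D) := by
    have : Module.Finite K (Polynomial.degreeLT K (D + 1)) :=
      Module.Finite.equiv (Polynomial.degreeLTEquiv K (D + 1)).symm
    rw [Module.finrank_pi_fintype, Finset.sum_const, (Polynomial.degreeLTEquiv K _).finrank_eq]
    simp only [Finset.card_univ, Fintype.card_coe, smul_eq_mul, Module.finrank_fin_fun]
    have h := six_mul_finrank_restrictTotalDegree K D
    have h2 : 6 * S.card < (D + 1) * (D + 1) := by rw [hD]; exact Nat.lt_succ_sqrt _
    nlinarith
  have : Module.Finite K (Polynomial.degreeLT K (D + 1)) :=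
    Module.Finite.equiv (Polynomial.degreeLTEquiv K (D + 1)).symm
  obtain ⟨f, hf, hf0⟩ := Submodule.exists_mem_ne_zero_of_ne_bot
    (LinearMap.ker_ne_bot_of_finrank_lt hfin (f := Φ))
  refine ⟨f.1, fun h => hf0 (Subtype.ext h), hD ▸ (mem_restrictTotalDegree _ _ _).1 f.2, ?_⟩
  intro q hq
  exact congrArg Subtype.val (congrFun (LinearMap.mem_ker.1 hf) ⟨q, hq⟩)

/-- A Wronskian criterion for proportionality of polynomials of small degree. -/
theorem eq_C_mul_of_derivative_mul_eq {p : ℕ} [CharP K p] {A B : Polynomial K} (hB : B ≠ 0)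
    (hA : A.natDegree < p) (hBp : B.natDegree < p)
    (h : Polynomial.derivative A * B = A * Polynomial.derivative B) :
    ∃ c : K, A = Polynomial.C c * B := by
  have key : ∀ A : Polynomial K, A ≠ 0 → A.natDegree < p →
      Polynomial.derivative A * B = A * Polynomial.derivative B → A.natDegree = B.natDegree := by
    intro A hA0 hA h
    have hd : ∀ f : Polynomial K, (Polynomial.X * Polynomial.derivative f).natDegree ≤
        f.natDegree := by
      intro f
      rcases Nat.eq_zero_or_pos f.natDegree with h0 | h0
      · rw [Polynomial.eq_C_of_natDegree_eq_zero h0]; simp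
      · have := Polynomial.natDegree_derivative_lt (p := f) h0.ne'
        refine Polynomial.natDegree_mul_le.trans ?_
        rw [Polynomial.natDegree_X]
        omega
    have hc : ∀ f : Polynomial K, (Polynomial.X * Polynomial.derivative f).coeff f.natDegree =
        f.natDegree * f.leadingCoeff := by
      intro f
      rcases h0 : f.natDegree with _ | n
      · simp
      · rw [Polynomial.coeff_X_mul, Polynomial.coeff_derivative, Polynomial.leadingCoeff, h0]
        push_cast; ring
    have h1 : (Polynomial.X * Polynomial.derivative A) * B =
        A * (Polynomial.X * Polynomial.derivative B) := by linear_combination Polynomial.X * h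
    have h2 := congrArg (fun f => Polynomial.coeff f (A.natDegree + B.natDegree)) h1
    rw [Polynomial.coeff_mul_add_eq_of_natDegree_le (hd A) le_rfl,
      Polynomial.coeff_mul_add_eq_of_natDegree_le le_rfl (hd B), hc, hc, Polynomial.coeff_natDegree,
      Polynomial.coeff_natDegree] at h2
    have hl : A.leadingCoeff * B.leadingCoeff ≠ 0 :=
      mul_ne_zero (Polynomial.leadingCoeff_ne_zero.2 hA0) (Polynomial.leadingCoeff_ne_zero.2 hB)
    have h3 : (A.natDegree : K) = B.natDegree :=
      mul_right_cancel₀ hl (by linear_combination h2)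
    exact CharP.natCast_injOn_Iio K p hA hBp h3
  let c := A.coeff B.natDegree / B.leadingCoeff
  refine ⟨c, ?_⟩
  by_contra hne
  have hlc := Polynomial.leadingCoeff_ne_zero.2 hB
  have hne' : A - Polynomial.C c * B ≠ 0 := sub_ne_zero.2 hne
  have hdeg : (A - Polynomial.C c * B).natDegree < p := by
    refine (Polynomial.natDegree_sub_le _ _).trans_lt (max_lt hA ?_)
    exact (Polynomial.natDegree_C_mul_le _ _).trans_lt hBp
  have h4 := key _ hne' hdeg (by
    simp only [Polynomial.derivative_sub, Polynomial.derivative_mul, Polynomial.derivative_C]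
    linear_combination h)
  have h5 : (A - Polynomial.C c * B).coeff B.natDegree = 0 := by
    rw [Polynomial.coeff_sub, Polynomial.coeff_C_mul, Polynomial.coeff_natDegree]
    simp only [c]
    field_simp
    ring
  rw [← h4, Polynomial.coeff_natDegree, Polynomial.leadingCoeff_eq_zero] at h5
  exact hne' h5

/-- If the ratio of two polynomials of small degree has vanishing Schwarzian-type
expression, the ratio is linear. -/
theorem exists_linear_ratio {p : ℕ} [CharP K p] {P R : Polynomial K} (hR : R ≠ 0) {e : ℕ}
    (he : 2 * e + 2 < p) (hPe : P.natDegree ≤ e) (hRe : R.natDegree ≤ e)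
    (h : R * (R * Polynomial.derivative (Polynomial.derivative P) -
        P * Polynomial.derivative (Polynomial.derivative R)) =
      2 * (R * Polynomial.derivative P - P * Polynomial.derivative R) *
        Polynomial.derivative R) :
    ∃ c d : K, P = (Polynomial.C c * Polynomial.X + Polynomial.C d) * R := by
  have hd : ∀ f : Polynomial K, (Polynomial.derivative f).natDegree ≤ f.natDegree :=
    fun f => (Polynomial.natDegree_derivative_le f).trans (Nat.sub_le _ _)
  obtain ⟨c, hc⟩ := eq_C_mul_of_derivative_mul_eq (p := p)
    (A := R * Polynomial.derivative P - P * Polynomial.derivative R) (B := R ^ 2)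
    (pow_ne_zero 2 hR) (by
      refine (Polynomial.natDegree_sub_le _ _).trans_lt (max_lt ?_ ?_)
      · have := hd P
        have := Polynomial.natDegree_mul_le (p := R) (q := Polynomial.derivative P)
        omega
      · have := hd R
        have := Polynomial.natDegree_mul_le (p := P) (q := Polynomial.derivative R)
        omega) (by
      have := Polynomial.natDegree_pow_le (p := R) (n := 2)
      omega) (by
      simp only [Polynomial.derivative_sub, Polynomial.derivative_mul, Polynomial.derivative_pow]
      simp only [Nat.cast_ofNat, map_ofNat, Nat.add_one_sub_one, pow_one]
      linear_combination R * h)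
  obtain ⟨d, hd'⟩ := eq_C_mul_of_derivative_mul_eq (p := p)
    (A := P - Polynomial.C c * Polynomial.X * R) (B := R) hR (by
      refine (Polynomial.natDegree_sub_le _ _).trans_lt (max_lt (by omega) ?_)
      have h1 := Polynomial.natDegree_mul_le (p := Polynomial.C c * Polynomial.X) (q := R)
      have h2 : (Polynomial.C c * Polynomial.X).natDegree ≤ 1 := by compute_degree
      omega) (by omega) (by
      simp only [Polynomial.derivative_sub, Polynomial.derivative_mul, Polynomial.derivative_C,
        Polynomial.derivative_X]
      linear_combination hc)
  exact ⟨c, d, by linear_combination hd'⟩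

/-- The symplectic-type form whose vanishing expresses that two null lines of different slope
meet. -/
def lineForm (q r : K × K × K) : K := q.1 * r.2.1 - r.1 * q.2.1 + q.2.2 - r.2.2

/-- The constant-coefficient derivation in direction `a`. -/
noncomputable def dirDeriv (a : Fin 3 → K) :
    Derivation K (MvPolynomial (Fin 3) K) (MvPolynomial (Fin 3) K) :=
  MvPolynomial.mkDerivation K fun i => MvPolynomial.C (a i)

theorem dirDeriv_comm (a b : Fin 3 → K) (f : MvPolynomial (Fin 3) K) :
    dirDeriv a (dirDeriv b f) = dirDeriv b (dirDeriv a f) := by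
  have : ⁅dirDeriv a, dirDeriv b⁆ = 0 := by
    apply MvPolynomial.derivation_ext
    intro i
    simp [dirDeriv, Derivation.commutator_apply]
  have h := DFunLike.congr_fun this f
  rw [Derivation.commutator_apply] at h
  exact sub_eq_zero.1 h

theorem dirDeriv_eq (a : Fin 3 → K) (f : MvPolynomial (Fin 3) K) :
    dirDeriv a f = MvPolynomial.C (a 0) * MvPolynomial.pderiv 0 f +
      MvPolynomial.C (a 1) * MvPolynomial.pderiv 1 f +
      MvPolynomial.C (a 2) * MvPolynomial.pderiv 2 f := by
  have : dirDeriv a = a 0 • MvPolynomial.pderiv 0 + a 1 • MvPolynomial.pderiv 1 +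
      a 2 • MvPolynomial.pderiv 2 := by
    apply MvPolynomial.derivation_ext
    intro i
    fin_cases i <;> simp [dirDeriv, MvPolynomial.pderiv_X, Algebra.smul_def]
  rw [this]
  simp [Algebra.smul_def]

theorem totalDegree_pderiv_le (i : Fin 3) (f : MvPolynomial (Fin 3) K) :
    (MvPolynomial.pderiv i f).totalDegree ≤ f.totalDegree - 1 := by
  classical
  refine Finset.sup_le fun s hs => ?_
  have h1 : s + Finsupp.single i 1 ∈ f.support := by
    rw [MvPolynomial.mem_support_iff] at hs ⊢
    rw [MvPolynomial.coeff_pderiv] at hs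
    exact left_ne_zero_of_mul hs
  have h2 := MvPolynomial.le_totalDegree h1
  rw [Finsupp.sum_add_index' (by simp) (by simp), Finsupp.sum_single_index rfl] at h2
  omega

theorem totalDegree_dirDeriv_le (a : Fin 3 → K) (f : MvPolynomial (Fin 3) K) :
    (dirDeriv a f).totalDegree ≤ f.totalDegree - 1 := by
  have h : ∀ c i, (MvPolynomial.C c * MvPolynomial.pderiv i f).totalDegree ≤
      f.totalDegree - 1 := fun c i =>
    (MvPolynomial.totalDegree_mul _ _).trans (by
      rw [MvPolynomial.totalDegree_C, zero_add]; exact totalDegree_pderiv_le i f)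
  rw [dirDeriv_eq]
  exact (MvPolynomial.totalDegree_add _ _).trans (max_le
    ((MvPolynomial.totalDegree_add _ _).trans (max_le (h _ _) (h _ _))) (h _ _))

/-- A polynomial of degree below the characteristic with vanishing partial derivatives is
constant. -/
theorem totalDegree_eq_zero_of_pderiv_eq_zero {p : ℕ} [CharP K p] {f : MvPolynomial (Fin 3) K}
    (hf : f.totalDegree < p) (h : ∀ i, MvPolynomial.pderiv i f = 0) : f.totalDegree = 0 := by
  classical
  by_contra h0
  rw [MvPolynomial.totalDegree_eq_zero_iff] at h0
  push Not at h0
  obtain ⟨s, hs, i, hi⟩ := h0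
  have h1 := MvPolynomial.le_totalDegree hs
  have h2 : s i ≤ s.sum fun _ e => e := by
    rw [Finsupp.sum_fintype _ _ (fun _ => rfl)]
    exact Finset.single_le_sum (f := fun i => s i) (fun _ _ => Nat.zero_le _) (Finset.mem_univ i)
  have h3 := congrArg (MvPolynomial.coeff (s - Finsupp.single i 1)) (h i)
  have h4 : s - Finsupp.single i 1 + Finsupp.single i 1 = s := by
    apply tsub_add_cancel_of_le
    rw [Finsupp.single_le_iff]
    omega
  rw [MvPolynomial.coeff_pderiv, h4, MvPolynomial.coeff_zero] at h3
  rcases mul_eq_zero.1 h3 with h5 | h5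
  · exact (MvPolynomial.mem_support_iff.1 hs) h5
  · have h6 : ((s i : ℕ) : K) = ((0 : ℕ) : K) := by
      rw [Finsupp.tsub_apply, Finsupp.single_eq_same] at h5
      rw [← Nat.sub_add_cancel (Nat.one_le_iff_ne_zero.2 hi)]
      push_cast
      simpa using h5
    exact hi (CharP.natCast_injOn_Iio K p (show s i < p by omega) (show 0 < p by omega) h6)

theorem derivative_lineRes (q : K × K × K) (f : MvPolynomial (Fin 3) K) :
    Polynomial.derivative (lineRes q f) = lineRes q (dirDeriv ![1, q.1 ^ 2, q.1] f) := by
  induction f using MvPolynomial.induction_on with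
  | C a => simp [dirDeriv]
  | add f g hf hg => simp [hf, hg]
  | mul_X f i hf =>
    rw [map_mul, Polynomial.derivative_mul, Derivation.leibniz, map_add, smul_eq_mul, smul_eq_mul,
      map_mul, map_mul, hf]
    have : Polynomial.derivative (lineRes q (MvPolynomial.X i)) =
        lineRes q (dirDeriv ![1, q.1 ^ 2, q.1] (MvPolynomial.X i)) := by
      fin_cases i
      · simp [lineRes_X0, dirDeriv]
      · rw [Fin.mk_one, lineRes_X1, dirDeriv, MvPolynomial.mkDerivation_X, lineRes_C]
        simp only [Polynomial.derivative_add, Polynomial.derivative_C, Polynomial.derivative_mul,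
          Polynomial.derivative_X]
        simp
      · simp [lineRes_X2, dirDeriv]
    rw [this]; ring

/-- The `x`-coordinate of the crossing point of two null lines. -/
def crossPt (q r : K × K × K) : K := (r.2.1 - q.2.1) / (q.1 - r.1)

theorem crossPt_mul {q r : K × K × K} (hm : q.1 ≠ r.1) :
    q.2.1 + q.1 * crossPt q r = r.2.1 + r.1 * crossPt q r := by
  have : q.1 - r.1 ≠ 0 := sub_ne_zero.2 hm
  rw [crossPt]; field_simp; ring

theorem eval_lineRes_eq (x : K) (q : K × K × K) (f : MvPolynomial (Fin 3) K) :
    (lineRes q f).eval x = MvPolynomial.eval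
      ![x, q.2.2 + q.1 * q.2.1 + q.1 ^ 2 * x, q.2.1 + q.1 * x] f := by
  have : (Polynomial.evalRingHom x).comp (lineRes q).toRingHom = MvPolynomial.eval
      ![x, q.2.2 + q.1 * q.2.1 + q.1 ^ 2 * x, q.2.1 + q.1 * x] := by
    apply MvPolynomial.ringHom_ext
    · intro r; simp
    · intro i; fin_cases i <;> simp [lineRes]
  exact DFunLike.congr_fun this f

theorem eval_lineRes_crossPt {q r : K × K × K} (hm : q.1 ≠ r.1) (h : lineForm q r = 0)
    (f : MvPolynomial (Fin 3) K) :
    (lineRes q f).eval (crossPt q r) = (lineRes r f).eval (crossPt q r) := by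
  have h1 := crossPt_mul hm
  have h2 : q.2.2 + q.1 * q.2.1 + q.1 ^ 2 * crossPt q r =
      r.2.2 + r.1 * r.2.1 + r.1 ^ 2 * crossPt q r := by
    rw [lineForm] at h
    linear_combination h + (q.1 + r.1) * h1
  rw [eval_lineRes_eq, eval_lineRes_eq, h1, h2]

theorem crossPt_injOn {q b c : K × K × K} (hb : q.1 ≠ b.1) (hc : q.1 ≠ c.1)
    (h1 : lineForm q b = 0) (h2 : lineForm q c = 0) (h : crossPt q b = crossPt q c) :
    lineForm b c = 0 := by
  have e1 := crossPt_mul hb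
  have e2 := crossPt_mul hc
  rw [h] at e1
  rw [lineForm] at *
  linear_combination h2 - h1 + (c.1 - q.1) * e1 - (b.1 - q.1) * e2

/-- The derivation along a null line, expanded in the frame of another slope. -/
theorem dirDeriv_expand (m n : K) (f : MvPolynomial (Fin 3) K) :
    dirDeriv ![1, n ^ 2, n] f = dirDeriv ![1, m ^ 2, m] f +
      MvPolynomial.C ((n - m) ^ 2) * dirDeriv ![0, 1, 0] f +
      MvPolynomial.C (n - m) * dirDeriv ![0, 2 * m, 1] f := by
  have h2 : (MvPolynomial.C 2 : MvPolynomial (Fin 3) K) = 2 := map_ofNat MvPolynomial.C 2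
  simp only [dirDeriv_eq]
  simp [h2]
  ring

section Surface
variable (m : K) (g : MvPolynomial (Fin 3) K)

/-- The second-order polynomial `U` attached to `g` in the frame of slope `m`; it vanishes at
points of `g = 0` through which two null lines of `g = 0` pass. -/
noncomputable def flecPoly : MvPolynomial (Fin 3) K :=
  let X := dirDeriv ![1, m ^ 2, m]
  let Y := dirDeriv ![(0 : K), 1, 0]
  let Z := dirDeriv ![0, 2 * m, 1]
  (Z g ^ 2 * X (X g) - 2 * Z g * X g * X (Z g) + X g ^ 2 * Z (Z g)) *
      (Z g ^ 2 - 2 * X g * Y g) +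
    2 * (Z g ^ 2 * X (Y g) - Z g * Y g * X (Z g) - X g * Z g * Y (Z g) + X g * Y g * Z (Z g)) *
      X g ^ 2

theorem totalDegree_flecPoly_le : (flecPoly m g).totalDegree ≤ 5 * g.totalDegree := by
  have mul : ∀ (a b : MvPolynomial (Fin 3) K) (i j k : ℕ), a.totalDegree ≤ i →
      b.totalDegree ≤ j → i + j = k → (a * b).totalDegree ≤ k := fun a b i j k h1 h2 h =>
    (MvPolynomial.totalDegree_mul _ _).trans (by omega)
  have sq : ∀ (a : MvPolynomial (Fin 3) K) (i k : ℕ), a.totalDegree ≤ i → 2 * i = k →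
      (a ^ 2).totalDegree ≤ k := fun a i k h1 h =>
    (MvPolynomial.totalDegree_pow _ _).trans (by omega)
  have hadd : ∀ (a b : MvPolynomial (Fin 3) K) (i : ℕ), a.totalDegree ≤ i →
      b.totalDegree ≤ i → (a + b).totalDegree ≤ i := fun a b i h1 h2 =>
    (MvPolynomial.totalDegree_add _ _).trans (max_le h1 h2)
  have sub : ∀ (a b : MvPolynomial (Fin 3) K) (i : ℕ), a.totalDegree ≤ i →
      b.totalDegree ≤ i → (a - b).totalDegree ≤ i := fun a b i h1 h2 =>
    (MvPolynomial.totalDegree_sub _ _).trans (max_le h1 h2)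
  have two : (2 : MvPolynomial (Fin 3) K).totalDegree ≤ 0 := by
    rw [← map_ofNat MvPolynomial.C 2, MvPolynomial.totalDegree_C]
  have d1 : ∀ a, (dirDeriv a g).totalDegree ≤ g.totalDegree := fun a =>
    (totalDegree_dirDeriv_le a g).trans (Nat.sub_le _ _)
  have d2 : ∀ a b, (dirDeriv a (dirDeriv b g)).totalDegree ≤ g.totalDegree := fun a b =>
    ((totalDegree_dirDeriv_le a _).trans (Nat.sub_le _ _)).trans (d1 b)
  generalize g.totalDegree = e at d1 d2
  have m3 : ∀ (a b c d : Fin 3 → K), (dirDeriv a g * dirDeriv b g *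
      dirDeriv c (dirDeriv d g)).totalDegree ≤ 3 * e := fun a b c d =>
    mul _ _ (2 * e) e _ (mul _ _ e e _ (d1 _) (d1 _) (by omega)) (d2 _ _) (by omega)
  have m3' : ∀ (a c d : Fin 3 → K), (dirDeriv a g ^ 2 *
      dirDeriv c (dirDeriv d g)).totalDegree ≤ 3 * e := fun a c d =>
    mul _ _ (2 * e) e _ (sq _ e _ (d1 _) (by omega)) (d2 _ _) (by omega)
  refine hadd _ _ _ (mul _ _ (3 * e) (2 * e) _ (hadd _ _ _ (sub _ _ _ (m3' _ _ _) ?_) (m3' _ _ _))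
    (sub _ _ _ (sq _ e _ (d1 _) (by omega)) ?_) (by omega))
    (mul _ _ (3 * e) (2 * e) _ (mul _ _ 0 (3 * e) _ two (hadd _ _ _ (sub _ _ _ (sub _ _ _
      (m3' _ _ _) (m3 _ _ _ _)) (m3 _ _ _ _)) (m3 _ _ _ _)) (by omega))
      (sq _ e _ (d1 _) (by omega)) (by omega))
  · exact mul _ _ (2 * e) e _ (mul _ _ e e _ (mul _ _ 0 e _ two (d1 _) (by omega)) (d1 _)
      (by omega)) (d2 _ _) (by omega)
  · exact mul _ _ e e _ (mul _ _ 0 e _ two (d1 _) (by omega)) (d1 _) (by omega)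

/-- First- and second-order conditions along a null line contained in `g = 0`. -/
theorem frame_relations {r : K × K × K} (hr : lineRes r g = 0) (x : K) :
    let X := dirDeriv ![1, m ^ 2, m]
    let Y := dirDeriv ![(0 : K), 1, 0]
    let Z := dirDeriv ![0, 2 * m, 1]
    let E := fun f => (lineRes r f).eval x
    let μ := r.1 - m
    E (X g) + μ ^ 2 * E (Y g) + μ * E (Z g) = 0 ∧
    E (X (X g)) + μ ^ 4 * E (Y (Y g)) + μ ^ 2 * E (Z (Z g)) + 2 * μ ^ 2 * E (X (Y g)) +
      2 * μ * E (X (Z g)) + 2 * μ ^ 3 * E (Y (Z g)) = 0 := by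
  intro X Y Z E μ
  have h1 := derivative_lineRes r g
  have h2 := derivative_lineRes r (dirDeriv ![1, r.1 ^ 2, r.1] g)
  rw [← h1, hr] at h2
  rw [hr] at h1
  simp only [Polynomial.derivative_zero] at h1 h2
  rw [dirDeriv_expand m r.1] at h1
  rw [dirDeriv_expand m r.1 g, dirDeriv_expand m r.1] at h2
  have h1' := congrArg (Polynomial.eval x) h1
  have h2' := congrArg (Polynomial.eval x) h2
  simp only [map_add, Derivation.leibniz, smul_eq_mul, map_mul, lineRes_C, Polynomial.eval_add,
    Polynomial.eval_mul, Polynomial.eval_C, Polynomial.eval_zero,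
    MvPolynomial.derivation_C, mul_zero, add_zero] at h1' h2'
  rw [dirDeriv_comm ![(0 : K), 1, 0] ![1, m ^ 2, m], dirDeriv_comm ![0, 2 * m, 1] ![1, m ^ 2, m],
    dirDeriv_comm ![0, 2 * m, 1] ![(0 : K), 1, 0]] at h2'
  constructor
  · simp only [E, X, Y, Z, μ]; linear_combination -h1'
  · simp only [E, X, Y, Z, μ]; linear_combination -h2'

theorem eval_flecPoly_eq_zero {q r : K × K × K} (hm : q.1 ≠ r.1) (hf : lineForm q r = 0)
    (hq : lineRes q g = 0) (hr : lineRes r g = 0) :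
    (lineRes q (flecPoly m g)).eval (crossPt q r) = 0 := by
  obtain ⟨a1, a2⟩ := frame_relations m g hq (crossPt q r)
  obtain ⟨b1, b2⟩ := frame_relations m g hr (crossPt q r)
  have hne : q.1 - r.1 ≠ 0 := sub_ne_zero.2 hm
  simp only [← eval_lineRes_crossPt hm hf] at b1 b2
  apply mul_left_cancel₀ hne
  simp only [flecPoly, map_add, map_sub, map_mul, map_pow, map_ofNat, Polynomial.eval_add,
    Polynomial.eval_sub, Polynomial.eval_mul, Polynomial.eval_pow, Polynomial.eval_ofNat]
  beta_reduce at a1 a2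
  generalize (lineRes q (dirDeriv ![1, m ^ 2, m] g)).eval (crossPt q r) = A at *
  generalize (lineRes q (dirDeriv ![0, 1, 0] g)).eval (crossPt q r) = P at *
  generalize (lineRes q (dirDeriv ![0, 2 * m, 1] g)).eval (crossPt q r) = R at *
  obtain ⟨μ, hμ⟩ : ∃ μ, μ = q.1 - m := ⟨_, rfl⟩
  obtain ⟨ν, hν⟩ : ∃ ν, ν = r.1 - m := ⟨_, rfl⟩
  rw [← hμ] at a1 a2
  rw [← hν] at b1 b2
  have hd : q.1 - r.1 = μ - ν := by rw [hμ, hν]; ring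
  rw [hd] at hne ⊢
  have hR : R = -P * (μ + ν) := by
    apply mul_left_cancel₀ hne; linear_combination a1 - b1
  have hA : A = P * μ * ν := by
    rw [hR] at a1; linear_combination a1
  subst hR hA
  linear_combination P ^ 4 * (μ + ν) * (μ ^ 4 * b2 - ν ^ 4 * a2)

theorem flecPoly_dvd_imp {q : K × K × K} (hq : lineRes q g = 0) (h : g ∣ flecPoly q.1 g)
    (hR0 : lineRes q (dirDeriv ![0, 2 * q.1, 1] g) ≠ 0) :
    let P := lineRes q (dirDeriv ![0, 1, 0] g)
    let R := lineRes q (dirDeriv ![0, 2 * q.1, 1] g)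
    R * (R * Polynomial.derivative (Polynomial.derivative P) -
        P * Polynomial.derivative (Polynomial.derivative R)) =
      2 * (R * Polynomial.derivative P - P * Polynomial.derivative R) *
        Polynomial.derivative R := by
  obtain ⟨m, v⟩ := q
  intro P R
  simp only [P, R]
  dsimp only at h hR0
  have hA : lineRes (m, v) (dirDeriv ![1, m ^ 2, m] g) = 0 := by
    rw [← derivative_lineRes (m, v), hq, Polynomial.derivative_zero]
  have hAA : lineRes (m, v) (dirDeriv ![1, m ^ 2, m] (dirDeriv ![1, m ^ 2, m] g)) = 0 := by
    rw [← derivative_lineRes (m, v), hA, Polynomial.derivative_zero]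
  simp only [derivative_lineRes]
  obtain ⟨c, hc⟩ := h
  have key : ∀ a, lineRes (m, v) (dirDeriv a (flecPoly m g)) =
      lineRes (m, v) (dirDeriv a g) * lineRes (m, v) c := by
    intro a
    rw [hc, Derivation.leibniz, map_add, smul_eq_mul, smul_eq_mul, map_mul, map_mul, hq]; ring
  have hY := key ![0, 1, 0]
  have hZ := key ![0, 2 * m, 1]
  simp only [flecPoly, Derivation.leibniz, Derivation.leibniz_pow, map_add, map_sub,
    smul_eq_mul, map_mul, map_pow, hA, hAA, mul_zero, zero_mul, add_zero, zero_add, sub_zero,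
    Nat.add_one_sub_one, pow_one, nsmul_eq_mul, map_ofNat, ne_eq, OfNat.ofNat_ne_zero,
    not_false_eq_true, zero_pow] at hY hZ
  simp only [dirDeriv_comm ![0, 2 * m, 1] ![1, m ^ 2, m],
    dirDeriv_comm ![0, 1, 0] ![1, m ^ 2, m]] at hY hZ
  apply mul_left_cancel₀ (pow_ne_zero 3 hR0)
  linear_combination lineRes (m, v) (dirDeriv ![0, 2 * m, 1] g) * hY -
    lineRes (m, v) (dirDeriv ![0, 1, 0] g) * hZ

end Surface

/-- A family of quadrics containing the null line `q`. -/
noncomputable def quadric (q : K × K × K) (c d : K) : MvPolynomial (Fin 3) K :=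
  let y : MvPolynomial (Fin 3) K := MvPolynomial.X 1 - MvPolynomial.C (2 * q.1) * MvPolynomial.X 2 +
    MvPolynomial.C (q.1 ^ 2) * MvPolynomial.X 0 + MvPolynomial.C (q.1 * q.2.1 - q.2.2)
  let z : MvPolynomial (Fin 3) K :=
    MvPolynomial.X 2 - MvPolynomial.C q.1 * MvPolynomial.X 0 - MvPolynomial.C q.2.1
  MvPolynomial.C c * (MvPolynomial.X 0 * y - z ^ 2) + MvPolynomial.C d * y + z

theorem totalDegree_quadric_le (q : K × K × K) (c d : K) : (quadric q c d).totalDegree ≤ 2 := by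
  have mul : ∀ (a b : MvPolynomial (Fin 3) K) (i j k : ℕ), a.totalDegree ≤ i →
      b.totalDegree ≤ j → i + j ≤ k → (a * b).totalDegree ≤ k := fun a b i j k h1 h2 h =>
    (MvPolynomial.totalDegree_mul _ _).trans (by omega)
  have hadd : ∀ (a b : MvPolynomial (Fin 3) K) (i : ℕ), a.totalDegree ≤ i →
      b.totalDegree ≤ i → (a + b).totalDegree ≤ i := fun a b i h1 h2 =>
    (MvPolynomial.totalDegree_add _ _).trans (max_le h1 h2)
  have sub : ∀ (a b : MvPolynomial (Fin 3) K) (i : ℕ), a.totalDegree ≤ i →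
      b.totalDegree ≤ i → (a - b).totalDegree ≤ i := fun a b i h1 h2 =>
    (MvPolynomial.totalDegree_sub _ _).trans (max_le h1 h2)
  have hX : ∀ i, (MvPolynomial.X i : MvPolynomial (Fin 3) K).totalDegree ≤ 1 := fun i => by simp
  have hC : ∀ (a : K) k, (MvPolynomial.C a : MvPolynomial (Fin 3) K).totalDegree ≤ k :=
    fun a k => by simp
  have hCX : ∀ (a : K) i, (MvPolynomial.C a * MvPolynomial.X i :
      MvPolynomial (Fin 3) K).totalDegree ≤ 1 := fun a i =>
    mul _ _ 0 1 1 (hC _ _) (hX _) (by norm_num)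
  have hy := hadd _ _ _ (hadd _ _ _ (sub _ _ _ (hX 1) (hCX (2 * q.1) 2)) (hCX (q.1 ^ 2) 0))
    (hC (q.1 * q.2.1 - q.2.2) 1)
  have hz := sub _ _ _ (sub _ _ _ (hX 2) (hCX q.1 0)) (hC q.2.1 1)
  refine hadd _ _ _ (hadd _ _ _ (mul _ _ 0 2 2 (hC _ _) (sub _ _ _ (mul _ _ 1 1 2 (hX _) hy le_rfl)
    ?_) le_rfl) (mul _ _ 0 1 2 (hC _ _) hy (by norm_num))) (hz.trans (by norm_num))
  exact (MvPolynomial.totalDegree_pow _ _).trans (by omega)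

theorem lineRes_quadric_eq_zero_iff (q r : K × K × K) (c d : K) :
    lineRes r (quadric q c d) = 0 ↔
      (-c * (r.2.1 - q.2.1) ^ 2 + d * (-lineForm q r + (r.1 - q.1) * (r.2.1 - q.2.1)) +
        (r.2.1 - q.2.1) = 0 ∧
      c * (-lineForm q r - (r.1 - q.1) * (r.2.1 - q.2.1)) + d * (r.1 - q.1) ^ 2 + (r.1 - q.1) = 0)
      := by
  have h : lineRes r (quadric q c d) =
      Polynomial.C (-c * (r.2.1 - q.2.1) ^ 2 +
        d * (-lineForm q r + (r.1 - q.1) * (r.2.1 - q.2.1)) + (r.2.1 - q.2.1)) +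
      Polynomial.C (c * (-lineForm q r - (r.1 - q.1) * (r.2.1 - q.2.1)) + d * (r.1 - q.1) ^ 2 +
        (r.1 - q.1)) * Polynomial.X := by
    have h2 : (Polynomial.C 2 : Polynomial K) = 2 := map_ofNat Polynomial.C 2
    simp only [quadric, map_add, map_sub, map_mul, map_pow, lineRes_X0, lineRes_X1, lineRes_X2,
      lineRes_C, lineForm, map_neg, h2]
    ring
  rw [h]
  constructor
  · intro h0
    have h1 := congrArg (fun f => Polynomial.coeff f 0) h0
    have h2 := congrArg (fun f => Polynomial.coeff f 1) h0
    simp only [Polynomial.coeff_add, Polynomial.coeff_C_mul, Polynomial.coeff_X_zero,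
      Polynomial.coeff_X_one, Polynomial.coeff_C_zero, Polynomial.coeff_zero, mul_zero, mul_one,
      add_zero, Polynomial.coeff_C_succ, zero_add] at h1 h2
    exact ⟨h1, h2⟩
  · rintro ⟨h1, h2⟩
    rw [h1, h2]; simp

/-- In a quadric through `q`, every line meeting `q` meets every line skew to `q`. -/
theorem lineForm_eq_zero_of_quadric {q r b : K × K × K} {c d : K}
    (hr : lineRes r (quadric q c d) = 0) (hb : lineRes b (quadric q c d) = 0)
    (hqr : lineForm q r ≠ 0) (hqb : lineForm q b = 0) (hm : q.1 ≠ b.1) : lineForm r b = 0 := by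
  rw [lineRes_quadric_eq_zero_iff] at hr hb
  obtain ⟨r1, r2⟩ := hr
  obtain ⟨b1, b2⟩ := hb
  have hrb : lineForm r b = (r.1 - q.1) * (b.2.1 - q.2.1) - (b.1 - q.1) * (r.2.1 - q.2.1) -
      lineForm q r + lineForm q b := by simp only [lineForm]; ring
  have hmb : b.1 - q.1 ≠ 0 := sub_ne_zero.2 hm.symm
  rw [hrb]
  rw [hqb] at *
  generalize lineForm q r = W at *
  generalize r.1 - q.1 = m at *
  generalize r.2.1 - q.2.1 = v at *
  generalize b.1 - q.1 = n at *
  generalize b.2.1 - q.2.1 = u at *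
  have e1 : -c * u + d * n + 1 = 0 := by
    apply mul_left_cancel₀ hmb; linear_combination b2
  have e2 : c * v = d * m := by
    apply mul_left_cancel₀ hqr
    linear_combination -v * r2 + m * r1
  have e3 : c * W = m := by linear_combination -r2 - m * e2
  by_cases hc : c = 0
  · subst hc
    have hm0 : m = 0 := by linear_combination -e3
    subst hm0
    have hd : d ≠ 0 := by rintro rfl; simp at e1
    apply mul_left_cancel₀ hd
    linear_combination r1 - v * e1
  · apply mul_left_cancel₀ hc
    linear_combination -m * e1 - n * e2 - e3

/-- A polynomial in one variable vanishing at too many crossing points is zero. -/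
theorem eq_zero_of_eval_crossPt {r : K × K × K} {T : Finset (K × K × K)} {f : Polynomial K}
    (hm : ∀ b ∈ T, r.1 ≠ b.1) (hr : ∀ b ∈ T, lineForm r b = 0)
    (hT : ∀ b ∈ T, ∀ b' ∈ T, b ≠ b' → lineForm b b' ≠ 0) (hf : f.natDegree < T.card)
    (h : ∀ b ∈ T, f.eval (crossPt r b) = 0) : f = 0 := by
  classical
  have hinj : Set.InjOn (crossPt r) T := by
    intro b hb b' hb' hbb
    by_contra hne
    exact hT b hb b' hb' hne (crossPt_injOn (hm b hb) (hm b' hb') (hr b hb) (hr b' hb') hbb)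
  refine Polynomial.eq_zero_of_natDegree_lt_card_of_eval_eq_zero' f (T.image (crossPt r)) ?_ ?_
  · intro x hx
    obtain ⟨b, hb, rfl⟩ := Finset.mem_image.1 hx
    exact h b hb
  · rwa [Finset.card_image_of_injOn hinj]

open Classical in
/-- If an irreducible surface of degree `e` contains more than `5 e ^ 2` red lines each meeting many
blue lines of the surface, then two of the red lines have many common neighbours. -/
theorem exists_many_common_neighbours {p : ℕ} [CharP K p] {g : MvPolynomial (Fin 3) K}
    (hg : Irreducible g) (hp : 2 * g.totalDegree + 2 < p) {Rd Bl : Finset (K × K × K)}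
    (hRd : 5 * g.totalDegree ^ 2 < Rd.card)
    (hR : ∀ r ∈ Rd, ∀ r' ∈ Rd, r ≠ r' → lineForm r r' ≠ 0)
    (hB : ∀ b ∈ Bl, ∀ b' ∈ Bl, b ≠ b' → lineForm b b' ≠ 0)
    (hm : ∀ r ∈ Rd, ∀ b ∈ Bl, r.1 ≠ b.1)
    (hRg : ∀ r ∈ Rd, lineRes r g = 0) (hBg : ∀ b ∈ Bl, lineRes b g = 0) (k : ℕ)
    (hk : ∀ r ∈ Rd, 5 * g.totalDegree < (Bl.filter fun b => lineForm r b = 0).card)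
    (hk' : ∀ r ∈ Rd, k < (Bl.filter fun b => lineForm r b = 0).card) :
    ∃ r ∈ Rd, ∃ r' ∈ Rd, r ≠ r' ∧
      k < (Bl.filter fun b => lineForm r b = 0 ∧ lineForm r' b = 0).card := by
  obtain ⟨e, he⟩ : ∃ e, e = g.totalDegree := ⟨_, rfl⟩
  rw [← he] at hp hRd hk
  have he1 : 1 ≤ e := by
    rw [Nat.one_le_iff_ne_zero, he]
    intro h0
    rw [MvPolynomial.totalDegree_eq_zero_iff_eq_C] at h0
    have hne : MvPolynomial.coeff 0 g ≠ 0 := by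
      intro h1
      rw [h1, map_zero] at h0
      exact hg.ne_zero h0
    exact hg.not_isUnit (h0 ▸ (isUnit_iff_ne_zero.2 hne).map MvPolynomial.C)
  -- a red line along which some partial derivative does not vanish
  have hex : ∃ q ∈ Rd, ∃ i, lineRes q (MvPolynomial.pderiv i g) ≠ 0 := by
    by_contra! hno
    have : g.totalDegree = 0 := by
      refine totalDegree_eq_zero_of_pderiv_eq_zero (p := p) (by omega) fun i => ?_
      have hd := totalDegree_pderiv_le i g
      have hdvd : g ∣ MvPolynomial.pderiv i g := by
        by_contra hnd
        have h1 := card_common_lines_le hg hnd Rd fun q hq => ⟨hRg q hq, hno q hq i⟩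
        rw [← he] at h1 hd
        have h2 := Nat.mul_le_mul_left e (hd.trans (Nat.sub_le _ _))
        nlinarith
      by_contra h0
      have := MvPolynomial.totalDegree_le_of_dvd_of_isDomain hdvd h0
      omega
    omega
  obtain ⟨q, hq, i, hi⟩ := hex
  set T := Bl.filter fun b => lineForm q b = 0 with hT
  have hTm : ∀ b ∈ T, q.1 ≠ b.1 := fun b hb => hm q hq b (Finset.mem_filter.1 hb).1
  have hTq : ∀ b ∈ T, lineForm q b = 0 := fun b hb => (Finset.mem_filter.1 hb).2
  have hTB : ∀ b ∈ T, ∀ b' ∈ T, b ≠ b' → lineForm b b' ≠ 0 := fun b hb b' hb' =>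
    hB b (Finset.mem_filter.1 hb).1 b' (Finset.mem_filter.1 hb').1
  have hTg : ∀ b ∈ T, lineRes b g = 0 := fun b hb => hBg b (Finset.mem_filter.1 hb).1
  have hUdvd : g ∣ flecPoly q.1 g := by
    by_contra hnd
    have h1 := card_common_lines_le hg hnd Rd fun r hr => ⟨hRg r hr, by
      refine eq_zero_of_eval_crossPt (r := r) (T := Bl.filter fun b => lineForm r b = 0)
        (fun b hb => hm r hr b (Finset.mem_filter.1 hb).1) (fun b hb => (Finset.mem_filter.1 hb).2)
        (fun b hb b' hb' => hB b (Finset.mem_filter.1 hb).1 b' (Finset.mem_filter.1 hb').1) ?_ ?_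
      · refine (natDegree_lineRes_le _ _).trans_lt ((totalDegree_flecPoly_le _ _).trans_lt ?_)
        rw [← he]; exact hk r hr
      · intro b hb
        obtain ⟨hb1, hb2⟩ := Finset.mem_filter.1 hb
        exact eval_flecPoly_eq_zero _ _ (hm r hr b hb1) hb2 (hRg r hr) (hBg b hb1)⟩
    have h2 := totalDegree_flecPoly_le q.1 g
    rw [← he] at h1 h2
    have h3 := Nat.mul_le_mul_left e h2
    nlinarith
  have hA : lineRes q (dirDeriv ![1, q.1 ^ 2, q.1] g) = 0 := by
    rw [← derivative_lineRes, hRg q hq, Polynomial.derivative_zero]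
  obtain ⟨P, hP⟩ : ∃ P, P = lineRes q (dirDeriv ![0, 1, 0] g) := ⟨_, rfl⟩
  obtain ⟨R, hRdef⟩ : ∃ R, R = lineRes q (dirDeriv ![0, 2 * q.1, 1] g) := ⟨_, rfl⟩
  have hPe : P.natDegree ≤ e := by
    rw [hP, he]
    exact (natDegree_lineRes_le _ _).trans ((totalDegree_dirDeriv_le _ _).trans (Nat.sub_le _ _))
  have hRe : R.natDegree ≤ e := by
    rw [hRdef, he]
    exact (natDegree_lineRes_le _ _).trans ((totalDegree_dirDeriv_le _ _).trans (Nat.sub_le _ _))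
  have hcross : ∀ b ∈ T, (b.1 - q.1) * P.eval (crossPt q b) + R.eval (crossPt q b) = 0 := by
    intro b hb
    have h1 := (frame_relations q.1 g (hTg b hb) (crossPt q b)).1
    beta_reduce at h1
    rw [← eval_lineRes_crossPt (hTm b hb) (hTq b hb), ← eval_lineRes_crossPt (hTm b hb) (hTq b hb),
      ← eval_lineRes_crossPt (hTm b hb) (hTq b hb), hA, ← hP, ← hRdef] at h1
    apply mul_left_cancel₀ (sub_ne_zero.2 (hTm b hb).symm)
    simp only [Polynomial.eval_zero] at h1
    linear_combination h1
  have hTcard : 5 * e < T.card := hk q hq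
  have hR0 : R ≠ 0 := by
    intro h0
    have hP0 : P = 0 := by
      refine eq_zero_of_eval_crossPt hTm hTq hTB (by omega) fun b hb => ?_
      have h1 := hcross b hb
      rw [h0, Polynomial.eval_zero, add_zero] at h1
      exact (mul_eq_zero.1 h1).resolve_left (sub_ne_zero.2 (hTm b hb).symm)
    rw [hP, dirDeriv_eq] at hP0
    rw [hRdef, dirDeriv_eq] at h0
    rw [dirDeriv_eq] at hA
    simp only [Matrix.cons_val_zero, Matrix.cons_val_one, Matrix.cons_val, map_zero, zero_mul,
      map_one, one_mul, zero_add, add_zero, map_add, map_mul, map_pow, lineRes_C] at hP0 h0 hA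
    rw [hP0, mul_zero, zero_add] at h0
    rw [hP0, h0, mul_zero, mul_zero, add_zero, add_zero] at hA
    fin_cases i
    · exact hi hA
    · exact hi hP0
    · exact hi h0
  obtain ⟨c, d, hcd⟩ := exists_linear_ratio (p := p) hR0 (by omega) hPe hRe (by
    rw [hP, hRdef]
    exact flecPoly_dvd_imp g (hRg q hq) hUdvd (hRdef ▸ hR0))
  have hline : ∀ b ∈ T, R.eval (crossPt q b) ≠ 0 → lineRes b (quadric q c d) = 0 := by
    intro b hb hne
    have h1 := hcross b hb
    have h2 := crossPt_mul (hTm b hb)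
    rw [hcd] at h1
    simp only [Polynomial.eval_mul, Polynomial.eval_add, Polynomial.eval_C, Polynomial.eval_X]
      at h1
    have h3 : (b.1 - q.1) * (c * crossPt q b + d) + 1 = 0 := by
      apply mul_right_cancel₀ hne
      linear_combination h1
    have h4 : -c * (b.2.1 - q.2.1) + d * (b.1 - q.1) + 1 = 0 := by
      linear_combination h3 + c * h2
    rw [lineRes_quadric_eq_zero_iff, hTq b hb]
    constructor
    · linear_combination (b.2.1 - q.2.1) * h4
    · linear_combination (b.1 - q.1) * h4
  have hsdvd : g ∣ quadric q c d := by
    by_contra hnd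
    have h1 := card_common_lines_le hg hnd (T.filter fun b => R.eval (crossPt q b) ≠ 0)
      fun b hb => ⟨hTg b (Finset.mem_filter.1 hb).1,
        hline b (Finset.mem_filter.1 hb).1 (Finset.mem_filter.1 hb).2⟩
    have h2 : (T.filter fun b => R.eval (crossPt q b) = 0).card ≤ e := by
      by_contra! hlt
      refine hR0 (eq_zero_of_eval_crossPt (T := T.filter fun b => R.eval (crossPt q b) = 0)
        (r := q) (fun b hb => hTm b (Finset.mem_filter.1 hb).1)
        (fun b hb => hTq b (Finset.mem_filter.1 hb).1)
        (fun b hb b' hb' => hTB b (Finset.mem_filter.1 hb).1 b' (Finset.mem_filter.1 hb').1)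
        (by omega) fun b hb => (Finset.mem_filter.1 hb).2)
    have h3 := Finset.card_filter_add_card_filter_not (s := T)
      (fun b => R.eval (crossPt q b) = 0)
    have h4 := Nat.mul_le_mul_left e (totalDegree_quadric_le q c d)
    rw [← he] at h1
    simp only [ne_eq] at h1
    omega
  have hin : ∀ r, lineRes r g = 0 → lineRes r (quadric q c d) = 0 := by
    intro r hr
    obtain ⟨f, hf⟩ := hsdvd
    rw [hf, map_mul, hr, zero_mul]
  obtain ⟨r, hr, hrq⟩ := Finset.exists_mem_ne (by nlinarith : 1 < Rd.card) q
  refine ⟨q, hq, r, hr, hrq.symm, (hk' q hq).trans_le (Finset.card_le_card fun b hb => ?_)⟩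
  refine Finset.mem_filter.2 ⟨(Finset.mem_filter.1 hb).1, hTq b hb, ?_⟩
  exact lineForm_eq_zero_of_quadric (hin r (hRg r hr)) (hin b (hTg b hb)) (hR q hq r hr hrq.symm)
    (hTq b hb) (hTm b hb)

theorem totalDegree_pos_of_not_isUnit {f : MvPolynomial (Fin 3) K} (h0 : f ≠ 0) (h : ¬ IsUnit f) :
    1 ≤ f.totalDegree := by
  rw [Nat.one_le_iff_ne_zero]
  intro hd
  rw [MvPolynomial.totalDegree_eq_zero_iff_eq_C] at hd
  have hne : MvPolynomial.coeff 0 f ≠ 0 := by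
    intro h1
    rw [h1, map_zero] at hd
    exact h0 hd
  exact h (hd ▸ (isUnit_iff_ne_zero.2 hne).map MvPolynomial.C)

open Classical in
/-- A red line not contained in the surface `f = 0` meets at most `deg f` blue lines of it. -/
theorem card_neighbours_in_surface_le {f : MvPolynomial (Fin 3) K} {r : K × K × K}
    {Bl : Finset (K × K × K)}
    (hB : ∀ b ∈ Bl, ∀ b' ∈ Bl, b ≠ b' → lineForm b b' ≠ 0) (hm : ∀ b ∈ Bl, r.1 ≠ b.1)
    (hr : lineRes r f ≠ 0) :
    (Bl.filter fun b => lineForm r b = 0 ∧ lineRes b f = 0).card ≤ f.totalDegree := by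
  by_contra! hlt
  refine hr (eq_zero_of_eval_crossPt (r := r) (fun b hb => hm b (mem_filter.1 hb).1)
    (fun b hb => (mem_filter.1 hb).2.1)
    (fun b hb b' hb' => hB b (mem_filter.1 hb).1 b' (mem_filter.1 hb').1)
    ((natDegree_lineRes_le r f).trans_lt hlt) fun b hb => ?_)
  obtain ⟨hb1, hb2, hb3⟩ := mem_filter.1 hb
  rw [eval_lineRes_crossPt (hm b hb1) hb2, hb3, Polynomial.eval_zero]

open Classical in
/-- `exists_many_common_neighbours` without the irreducibility assumption. -/
theorem exists_many_common_neighbours_of_surface {p : ℕ} [CharP K p] (k n : ℕ) :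
    ∀ (f : MvPolynomial (Fin 3) K), f.totalDegree = n → f ≠ 0 → 2 * f.totalDegree + 2 < p →
    ∀ (Rd Bl : Finset (K × K × K)), 6 * f.totalDegree ^ 2 < Rd.card →
    (∀ r ∈ Rd, ∀ r' ∈ Rd, r ≠ r' → lineForm r r' ≠ 0) →
    (∀ b ∈ Bl, ∀ b' ∈ Bl, b ≠ b' → lineForm b b' ≠ 0) →
    (∀ r ∈ Rd, ∀ b ∈ Bl, r.1 ≠ b.1) →
    (∀ r ∈ Rd, lineRes r f = 0) → (∀ b ∈ Bl, lineRes b f = 0) →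
    (∀ r ∈ Rd, 6 * f.totalDegree + k < (Bl.filter fun b => lineForm r b = 0).card) →
    ∃ r ∈ Rd, ∃ r' ∈ Rd, r ≠ r' ∧
      k < (Bl.filter fun b => lineForm r b = 0 ∧ lineForm r' b = 0).card := by
  induction n using Nat.strong_induction_on with
  | _ n ih =>
  intro f hn hf hp Rd Bl hRd hR hB hm hRf hBf hk
  have hunit : ¬ IsUnit f := by
    intro hu
    obtain ⟨r, hr⟩ := Finset.card_pos.1 (by omega : 0 < Rd.card)
    exact (hu.map (lineRes r)).ne_zero (hRf r hr)
  obtain ⟨g, hg, hgf⟩ := WfDvdMonoid.exists_irreducible_factor hunit hf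
  obtain ⟨f', hfe, hf'⟩ := FiniteMultiplicity.exists_eq_pow_mul_and_not_dvd
    (FiniteMultiplicity.of_not_isUnit hg.not_isUnit hf)
  generalize multiplicity g f = a at hfe
  have hg1 := totalDegree_pos_of_not_isUnit hg.ne_zero hg.not_isUnit
  have hf'0 : f' ≠ 0 := by rintro rfl; simp at hf'
  have ha : a ≠ 0 := by
    rintro rfl
    rw [pow_zero, one_mul] at hfe
    exact hf' (hfe ▸ hgf)
  have hdeg : g.totalDegree + f'.totalDegree ≤ f.totalDegree := by
    obtain ⟨u, rfl⟩ := Nat.exists_eq_succ_of_ne_zero ha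
    rw [pow_succ', mul_assoc] at hfe
    have hu : g ^ u * f' ≠ 0 := mul_ne_zero (pow_ne_zero _ hg.ne_zero) hf'0
    rw [hfe, MvPolynomial.totalDegree_mul_of_isDomain hg.ne_zero hu,
      MvPolynomial.totalDegree_mul_of_isDomain (pow_ne_zero _ hg.ne_zero) hf'0]
    omega
  have hsplit : ∀ q, lineRes q f = 0 → lineRes q g = 0 ∨ lineRes q f' = 0 := by
    intro q hq
    rw [hfe, map_mul, map_pow, mul_eq_zero] at hq
    exact hq.imp_left fun h => pow_eq_zero_iff ha |>.1 h
  have h1 := card_common_lines_le hg hf' (Rd.filter fun r => lineRes r g = 0 ∧ lineRes r f' = 0)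
    fun q hq => (mem_filter.1 hq).2
  set Rg := Rd.filter fun r => lineRes r f' ≠ 0 with hRg
  set Rf := Rd.filter fun r => lineRes r g ≠ 0 with hRf'
  have hcard : Rd.card ≤ (Rd.filter fun r => lineRes r g = 0 ∧ lineRes r f' = 0).card +
      Rg.card + Rf.card := by
    refine (Finset.card_le_card fun r hr => ?_).trans
      ((card_union_le _ _).trans (Nat.add_le_add_right (card_union_le _ _) _))
    simp only [mem_union, mem_filter, hRg, hRf']
    tauto
  have hsplitB : ∀ r : K × K × K, (Bl.filter fun b => lineForm r b = 0).card ≤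
      ((Bl.filter fun b => lineRes b g = 0).filter fun b => lineForm r b = 0).card +
      ((Bl.filter fun b => lineRes b f' = 0).filter fun b => lineForm r b = 0).card := by
    intro r
    refine (Finset.card_le_card fun b hb => ?_).trans (card_union_le _ _)
    have := hsplit b (hBf b (mem_filter.1 hb).1)
    simp only [mem_union, mem_filter] at hb ⊢
    tauto
  have hcomm : ∀ (r : K × K × K) (h : MvPolynomial (Fin 3) K),
      ((Bl.filter fun b => lineRes b h = 0).filter fun b => lineForm r b = 0) =
      Bl.filter fun b => lineForm r b = 0 ∧ lineRes b h = 0 := by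
    intro r h
    ext b
    simp only [mem_filter]
    tauto
  have key : ∀ (h : MvPolynomial (Fin 3) K) (R' : Finset (K × K × K)), R' ⊆ Rd →
      (∃ r ∈ R', ∃ r' ∈ R', r ≠ r' ∧
      k < ((Bl.filter fun b => lineRes b h = 0).filter
        fun b => lineForm r b = 0 ∧ lineForm r' b = 0).card) →
      ∃ r ∈ Rd, ∃ r' ∈ Rd, r ≠ r' ∧
      k < (Bl.filter fun b => lineForm r b = 0 ∧ lineForm r' b = 0).card := by
    rintro h R' hR' ⟨r, hr, r', hr', hne, hlt⟩
    exact ⟨r, hR' hr, r', hR' hr', hne, hlt.trans_le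
      (card_le_card (filter_subset_filter _ (filter_subset _ _)))⟩
  by_cases hgR : 5 * g.totalDegree ^ 2 < Rg.card
  · have hlow : ∀ r ∈ Rg, 5 * g.totalDegree + k <
        ((Bl.filter fun b => lineRes b g = 0).filter fun b => lineForm r b = 0).card := by
      intro r hr
      obtain ⟨hr1, hr2⟩ := mem_filter.1 hr
      have h2 := hsplitB r
      have h3 := hk r hr1
      have h4 := card_neighbours_in_surface_le hB (hm r hr1) hr2
      rw [hcomm r f'] at h2
      omega
    refine key g Rg (filter_subset _ _) (exists_many_common_neighbours (p := p) hg (by omega) hgR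
      ?_ ?_ ?_ ?_ ?_ k (fun r hr => ?_) (fun r hr => ?_))
    · exact fun r hr r' hr' => hR r (mem_filter.1 hr).1 r' (mem_filter.1 hr').1
    · exact fun r hr r' hr' => hB r (mem_filter.1 hr).1 r' (mem_filter.1 hr').1
    · exact fun r hr b hb => hm r (mem_filter.1 hr).1 b (mem_filter.1 hb).1
    · exact fun r hr => (hsplit r (hRf r (mem_filter.1 hr).1)).resolve_right (mem_filter.1 hr).2
    · exact fun b hb => (mem_filter.1 hb).2
    · have := hlow r hr; omega
    · have := hlow r hr; omega
  · refine key f' Rf (filter_subset _ _) (ih f'.totalDegree (by omega) f' rfl hf'0 (by omega) Rf _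
      ?_ ?_ ?_ ?_ ?_ ?_ fun r hr => ?_)
    · have h2 : 6 * (g.totalDegree + f'.totalDegree) ^ 2 ≤ 6 * f.totalDegree ^ 2 := by gcongr
      nlinarith
    · exact fun r hr r' hr' => hR r (mem_filter.1 hr).1 r' (mem_filter.1 hr').1
    · exact fun r hr r' hr' => hB r (mem_filter.1 hr).1 r' (mem_filter.1 hr').1
    · exact fun r hr b hb => hm r (mem_filter.1 hr).1 b (mem_filter.1 hb).1
    · exact fun r hr => (hsplit r (hRf r (mem_filter.1 hr).1)).resolve_left (mem_filter.1 hr).2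
    · exact fun b hb => (mem_filter.1 hb).2
    · obtain ⟨hr1, hr2⟩ := mem_filter.1 hr
      have h2 := hsplitB r
      have h3 := hk r hr1
      have h4 := card_neighbours_in_surface_le hB (hm r hr1) hr2
      rw [hcomm r g] at h2
      omega

open Classical in
/-- If many red lines each meet many of the blue lines, then two of them have many common
neighbours. -/
theorem exists_many_common_neighbours_of_rich {p : ℕ} [CharP K p] (k : ℕ)
    {Rd Bl : Finset (K × K × K)} {d : ℕ} (hd : Nat.sqrt (6 * Bl.card) ≤ d) (hp : 2 * d + 2 < p)
    (hRd : 6 * d ^ 2 < Rd.card)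
    (hR : ∀ r ∈ Rd, ∀ r' ∈ Rd, r ≠ r' → lineForm r r' ≠ 0)
    (hB : ∀ b ∈ Bl, ∀ b' ∈ Bl, b ≠ b' → lineForm b b' ≠ 0)
    (hm : ∀ r ∈ Rd, ∀ b ∈ Bl, r.1 ≠ b.1)
    (hk : ∀ r ∈ Rd, 6 * d + k < (Bl.filter fun b => lineForm r b = 0).card) :
    ∃ r ∈ Rd, ∃ r' ∈ Rd, r ≠ r' ∧
      k < (Bl.filter fun b => lineForm r b = 0 ∧ lineForm r' b = 0).card := by
  obtain ⟨f, hf, hfd, hfB⟩ := exists_polynomial_vanishing_on_lines Bl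
  have hfd' := hfd.trans hd
  refine exists_many_common_neighbours_of_surface (p := p) k _ f rfl hf (by omega) Rd Bl
    (lt_of_le_of_lt (by gcongr) hRd) hR hB hm (fun r hr => ?_) hfB
    (fun r hr => lt_of_le_of_lt (by gcongr) (hk r hr))
  by_contra hne
  have h1 := card_neighbours_in_surface_le hB (hm r hr) hne
  have h2 := hk r hr
  have h3 : (Bl.filter fun b => lineForm r b = 0 ∧ lineRes b f = 0) =
      Bl.filter fun b => lineForm r b = 0 :=
    filter_congr fun b hb => and_iff_left (hfB b hb)
  rw [h3] at h1
  omega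

open Classical in
/-- The number of incidences between red and blue null lines. -/
noncomputable def crossings (R B : Finset (K × K × K)) : ℕ :=
  ∑ r ∈ R, (B.filter fun b => lineForm r b = 0).card

open Classical in
theorem crossings_le_mul (R B : Finset (K × K × K)) : crossings R B ≤ R.card * B.card := by
  rw [crossings, ← smul_eq_mul, ← sum_const]
  exact sum_le_sum fun r _ => card_filter_le _ _

open Classical in
theorem crossings_split_right (R B : Finset (K × K × K)) {B' : Finset (K × K × K)} (h : B' ⊆ B) :
    crossings R B = crossings R B' + crossings R (B \ B') := by
  rw [crossings, crossings, crossings, ← sum_add_distrib]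
  refine sum_congr rfl fun r _ => ?_
  rw [← card_union_of_disjoint (disjoint_filter_filter disjoint_sdiff), ← filter_union,
    union_sdiff_of_subset h]

open Classical in
theorem crossings_le_rich (R B : Finset (K × K × K)) (H : ℕ) :
    crossings R B ≤
      crossings (R.filter fun r => H < (B.filter fun b => lineForm r b = 0).card) B
        + R.card * H := by
  rw [crossings, crossings,
    ← sum_filter_add_sum_filter_not R fun r => H < (B.filter fun b => lineForm r b = 0).card]
  gcongr
  refine (sum_le_card_nsmul _ _ H fun r hr => not_lt.1 (mem_filter.1 hr).2).trans ?_
  rw [smul_eq_mul]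
  gcongr
  exact filter_subset _ _

open Classical in
/-- Red and blue families of pairwise disjoint null lines such that two red lines have at most `k`
common neighbours. -/
structure IsDisjointPair (k : ℕ) (R B : Finset (K × K × K)) : Prop where
  red : ∀ r ∈ R, ∀ r' ∈ R, r ≠ r' → lineForm r r' ≠ 0
  blue : ∀ b ∈ B, ∀ b' ∈ B, b ≠ b' → lineForm b b' ≠ 0
  slope : ∀ r ∈ R, ∀ b ∈ B, r.1 ≠ b.1
  common : ∀ r ∈ R, ∀ r' ∈ R, r ≠ r' →
    (B.filter fun b => lineForm r b = 0 ∧ lineForm r' b = 0).card ≤ k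

open Classical in
theorem IsDisjointPair.mono {k : ℕ} {R B R' B' : Finset (K × K × K)} (h : IsDisjointPair k R B)
    (hR : R' ⊆ R) (hB : B' ⊆ B) : IsDisjointPair k R' B' where
  red r hr r' hr' := h.red r (hR hr) r' (hR hr')
  blue b hb b' hb' := h.blue b (hB hb) b' (hB hb')
  slope r hr b hb := h.slope r (hR hr) b (hB hb)
  common r hr r' hr' hne := (card_le_card (filter_subset_filter _ hB)).trans
    (h.common r (hR hr) r' (hR hr') hne)

theorem crossings_le_of_parameter {η y : ℝ} (hη : 0 < η) (hy : 0 < y) (hy1 : y ≤ 1 / 10000)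
    (hy2 : (74 * y) ^ (1 + η) ≤ y / 2) {p : ℕ} [CharP K p] {N₀ k : ℕ} (hk : k ^ 2 ≤ N₀)
    (hp : N₀ ≤ p ^ 2) (N : ℕ) : N ≤ N₀ →
    ∀ R B : Finset (K × K × K), R.card + B.card = N → IsDisjointPair k R B →
      (crossings R B : ℝ) ≤ 14 / y * (N : ℝ) ^ (1 + η) * √N₀ := by
  induction N using Nat.strong_induction_on with
  | _ N ih =>
  intro hN R B hRB h
  have hle : (crossings R B : ℝ) ≤ R.card * B.card := mod_cast crossings_le_mul R B
  have hRBr : (R.card : ℝ) + B.card = N := mod_cast hRB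
  rcases Nat.eq_zero_or_pos N with rfl | hN1
  · have h1 : (R.card : ℝ) = 0 := by
      have : R.card = 0 := by omega
      exact_mod_cast this
    rw [h1, zero_mul] at hle
    exact hle.trans (by positivity)
  have hNr : (1 : ℝ) ≤ N := mod_cast hN1
  have hN0r : (N : ℝ) ≤ N₀ := mod_cast hN
  have hs1 : 1 ≤ √(N₀ : ℝ) := Real.one_le_sqrt.2 (hNr.trans hN0r)
  have hNη : (N : ℝ) ≤ (N : ℝ) ^ (1 + η) := by
    conv_lhs => rw [← Real.rpow_one (N : ℝ)]
    exact Real.rpow_le_rpow_of_exponent_le hNr (by linarith)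
  have hRN : (R.card : ℝ) ≤ N := by rw [← hRBr]; simp
  have hBN : (B.card : ℝ) ≤ N := by rw [← hRBr]; simp
  set F : ℝ := 14 / y * (N : ℝ) ^ (1 + η) * √N₀ with hF
  have hF0 : 0 ≤ F := by positivity
  have hscale : ∀ (M : ℕ) (t : ℝ), 0 ≤ t → (M : ℝ) ≤ t * N →
      14 / y * (M : ℝ) ^ (1 + η) * √N₀ ≤ t ^ (1 + η) * F := by
    intro M t ht hM
    have h1 : (M : ℝ) ^ (1 + η) ≤ t ^ (1 + η) * (N : ℝ) ^ (1 + η) := by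
      rw [← Real.mul_rpow ht (by positivity)]
      exact Real.rpow_le_rpow (by positivity) hM (by linarith)
    calc _ ≤ 14 / y * (t ^ (1 + η) * (N : ℝ) ^ (1 + η)) * √N₀ := by gcongr
      _ = _ := by rw [hF]; ring
  by_cases hsmall : y * N ≤ 1
  · calc (crossings R B : ℝ) ≤ R.card * B.card := hle
      _ ≤ N * N := by gcongr
      _ ≤ 14 / y * N * 1 := by
        rw [mul_one]
        gcongr
        rw [le_div_iff₀ hy]
        linarith
      _ ≤ F := by rw [hF]; gcongr
  push Not at hsmall
  by_contra! hX
  have hyN : y * N ≤ N / 10000 := by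
    have := mul_le_mul_of_nonneg_right hy1 (show (0 : ℝ) ≤ N by positivity)
    linarith
  obtain ⟨b₀, hb0⟩ : ∃ b₀, b₀ = ⌈y * N⌉₊ := ⟨_, rfl⟩
  have hb1 : y * N ≤ b₀ := hb0 ▸ Nat.le_ceil _
  have hb2 : (b₀ : ℝ) ≤ 2 * (y * N) := by
    have := Nat.ceil_lt_add_one (show 0 ≤ y * N by positivity)
    rw [hb0]; linarith
  have hb3 : 1 ≤ b₀ := by
    have : (1 : ℝ) ≤ b₀ := hsmall.le.trans hb1
    exact_mod_cast this
  -- a small subset of the blue lines with its share of the incidences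
  obtain ⟨B', hB', hB'c, hB'X⟩ : ∃ B' ⊆ B, B'.card ≤ b₀ ∧ y * F < crossings R B' := by
    rcases le_or_gt B.card b₀ with hle' | hlt
    · refine ⟨B, Subset.rfl, hle', lt_of_le_of_lt ?_ hX⟩
      nlinarith
    · obtain ⟨B', hB', hc⟩ := exists_subset_card_eq hlt.le
      refine ⟨B', hB', hc.le, ?_⟩
      classical
      have h1 := crossings_split_right R B hB'
      have h2 : (B \ B').card = B.card - b₀ := by rw [card_sdiff_of_subset hB', hc]
      have h3 := ih (N - b₀) (by omega) (by omega) R (B \ B') (by omega)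
        (h.mono Subset.rfl sdiff_subset)
      have h4 : ((N - b₀ : ℕ) : ℝ) ≤ (1 - y) * N := by
        rw [Nat.cast_sub (by omega)]; linarith
      have h5 := h3.trans (hscale _ _ (by linarith) h4)
      have h6 : (1 - y) ^ (1 + η) ≤ 1 - y := by
        conv_rhs => rw [← Real.rpow_one (1 - y)]
        exact Real.rpow_le_rpow_of_exponent_ge (by linarith) (by linarith) (by linarith)
      have h7 : (crossings R B : ℝ) = crossings R B' + crossings R (B \ B') := mod_cast h1
      have h8 := mul_le_mul_of_nonneg_right h6 hF0
      linarith
  obtain ⟨d, hd⟩ : ∃ d, d = Nat.sqrt (6 * b₀) := ⟨_, rfl⟩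
  have hd2 : d ^ 2 ≤ 6 * b₀ := hd ▸ Nat.sqrt_le' _
  have hd2r : (d : ℝ) ^ 2 ≤ 12 * y * N := by
    have : (d : ℝ) ^ 2 ≤ 6 * b₀ := mod_cast hd2
    linarith
  have hdN : (d : ℝ) ≤ √N₀ := by
    refine Real.le_sqrt_of_sq_le (hd2r.trans ?_)
    linarith
  have hkN : (k : ℝ) ≤ √N₀ := Real.le_sqrt_of_sq_le (mod_cast hk)
  classical
  set R₁ := R.filter fun r => 6 * d + k < (B'.filter fun b => lineForm r b = 0).card with hR₁
  have h1 : (crossings R B' : ℝ) ≤ crossings R₁ B' + R.card * (6 * d + k : ℕ) :=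
    mod_cast crossings_le_rich R B' (6 * d + k)
  have h2 : (R.card : ℝ) * (6 * d + k : ℕ) ≤ y / 2 * F := by
    calc (R.card : ℝ) * (6 * d + k : ℕ) ≤ N * (7 * √N₀) := by
          gcongr
          push_cast
          linarith
      _ ≤ (N : ℝ) ^ (1 + η) * (7 * √N₀) := by gcongr
      _ = y / 2 * F := by rw [hF]; field_simp; norm_num
  have h3 : y / 2 * F < crossings R₁ B' := by linarith
  have hR₁R : R₁ ⊆ R := filter_subset _ _
  have hpair := h.mono hR₁R hB'
  have hcard : 6 * d ^ 2 < R₁.card := by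
    by_contra! hle'
    have h4 : ((R₁.card + B'.card : ℕ) : ℝ) ≤ 74 * y * N := by
      have h5 : R₁.card + B'.card ≤ 37 * b₀ := by omega
      have h6 : ((R₁.card + B'.card : ℕ) : ℝ) ≤ 37 * b₀ := mod_cast h5
      linarith
    have h5 : R₁.card + B'.card < N := by
      have : ((R₁.card + B'.card : ℕ) : ℝ) < N := by linarith
      exact_mod_cast this
    have h6 := (ih _ h5 (by omega) R₁ B' rfl hpair).trans (hscale _ _ (by positivity) h4)
    have h7 := mul_le_mul_of_nonneg_right hy2 hF0
    linarith
  have hpd : 2 * d + 2 < p := by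
    have hpr : (N₀ : ℝ) ≤ (p : ℝ) ^ 2 := mod_cast hp
    have h4 : (1 : ℝ) ≤ y * (p : ℝ) ^ 2 := hsmall.le.trans (by gcongr; linarith)
    have h5 : (10 : ℝ) ^ 2 ≤ (p : ℝ) ^ 2 := by
      have := mul_le_mul_of_nonneg_right hy1 (show (0 : ℝ) ≤ (p : ℝ) ^ 2 by positivity)
      linarith
    have h6 : (10 : ℝ) ≤ p := le_of_sq_le_sq h5 (by positivity)
    have h7 : (d : ℝ) ^ 2 ≤ ((p : ℝ) / 5) ^ 2 := by
      rw [div_pow]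
      linarith
    have h8 : (d : ℝ) ≤ p / 5 := le_of_sq_le_sq h7 (by positivity)
    have h9 : (2 * d + 2 : ℝ) < p := by linarith
    exact_mod_cast h9
  obtain ⟨r, hr, r', hr', hne, hlt⟩ := exists_many_common_neighbours_of_rich (p := p) k (d := d)
    (by rw [hd]; exact Nat.sqrt_le_sqrt (by omega)) hpd hcard hpair.red hpair.blue hpair.slope
    fun r hr => (mem_filter.1 hr).2
  exact absurd (hpair.common r hr r' hr' hne) (not_le.2 hlt)

end NullLines

/-- The incidence bound for families of disjoint null lines. -/
theorem exists_crossings_bound {η : ℝ} (hη : 0 < η) (hη1 : η ≤ 1) :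
    ∃ C : ℝ, 0 < C ∧ ∀ (K : Type) [Field K] (p : ℕ) [CharP K p] (N₀ k : ℕ), k ^ 2 ≤ N₀ →
      N₀ ≤ p ^ 2 → ∀ R B : Finset (K × K × K), R.card + B.card ≤ N₀ → IsDisjointPair k R B →
      (crossings R B : ℝ) ≤ C * (N₀ : ℝ) ^ (3 / 2 + η) := by
  set y : ℝ := (1 / 10952) ^ (1 / η) with hy
  have hy0 : 0 < y := by positivity
  have hyη : y ^ η = 1 / 10952 := by
    rw [hy, ← Real.rpow_mul (by norm_num), one_div_mul_cancel hη.ne', Real.rpow_one]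
  have hy1 : y ≤ 1 / 10952 := by
    rw [hy]
    conv_rhs => rw [← Real.rpow_one (1 / 10952 : ℝ)]
    exact Real.rpow_le_rpow_of_exponent_ge (by norm_num) (by norm_num)
      ((one_le_div hη).2 hη1)
  have hy2 : (74 * y) ^ (1 + η) ≤ y / 2 := by
    have h1 : (74 : ℝ) ^ η ≤ 74 := by
      conv_rhs => rw [← Real.rpow_one (74 : ℝ)]
      exact Real.rpow_le_rpow_of_exponent_le (by norm_num) hη1
    rw [Real.rpow_add (by positivity), Real.rpow_one, Real.mul_rpow (by norm_num) hy0.le, hyη]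
    nlinarith
  refine ⟨14 / y, by positivity, fun K _ p _ N₀ k hk hp R B hRB h => ?_⟩
  refine (crossings_le_of_parameter hη hy0 (by linarith) hy2 hk hp _ hRB R B rfl h).trans ?_
  rw [mul_assoc]
  gcongr
  rcases Nat.eq_zero_or_pos N₀ with rfl | hpos
  · simp; positivity
  have hpos' : (0 : ℝ) < N₀ := mod_cast hpos
  rw [show (3 / 2 + η : ℝ) = (1 + η) + 1 / 2 by ring, Real.rpow_add hpos', Real.sqrt_eq_rpow]
  gcongr

/-- The Cauchy–Schwarz inequality for the fibres of a map into a set with few elements. -/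
theorem card_sq_le_card_mul_card_fibres {α β : Type*} [DecidableEq β] (T : Finset α) (f : α → β) (B : Finset β)
    (hf : ∀ t ∈ T, f t ∈ B) :
    T.card ^ 2 ≤ B.card * ((T ×ˢ T).filter fun q => f q.1 = f q.2).card := by
  classical
  have h1 : T.card = ∑ v ∈ B, (T.filter fun t => f t = v).card :=
    card_eq_sum_card_fiberwise hf
  have h2 : ((T ×ˢ T).filter fun q => f q.1 = f q.2).card =
      ∑ v ∈ B, (T.filter fun t => f t = v).card ^ 2 := by
    rw [card_eq_sum_card_fiberwise (f := fun q : α × α => f q.1) (t := B) fun q hq =>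
      hf _ (mem_product.1 (mem_filter.1 hq).1).1]
    refine sum_congr rfl fun v _ => ?_
    rw [sq, ← card_product]
    congr 1
    ext ⟨a, b⟩
    simp only [mem_filter, mem_product]
    constructor
    · rintro ⟨⟨⟨ha, hb⟩, hab⟩, hv⟩
      exact ⟨⟨ha, hv⟩, hb, hab ▸ hv⟩
    · rintro ⟨⟨ha, hv⟩, hb, hv'⟩
      exact ⟨⟨⟨ha, hb⟩, hv.trans hv'.symm⟩, hv⟩
  rw [h2]
  conv_lhs => rw [h1]
  exact sq_sum_le_card_mul_sum_sq

section Lifting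
variable {F : Type} [Field F]

theorem ratFunc_cubic_eq_zero {a b c d : F}
    (h : RatFunc.C a + RatFunc.C b * RatFunc.X + RatFunc.C c * RatFunc.X ^ 2 +
      RatFunc.C d * RatFunc.X ^ 3 = 0) : a = 0 ∧ b = 0 ∧ c = 0 ∧ d = 0 := by
  have h1 : algebraMap (Polynomial F) (RatFunc F) (Polynomial.C a + Polynomial.C b * Polynomial.X +
      Polynomial.C c * Polynomial.X ^ 2 + Polynomial.C d * Polynomial.X ^ 3) = 0 := by
    simpa only [map_add, map_mul, map_pow, RatFunc.algebraMap_C, RatFunc.algebraMap_X] using h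
  rw [map_eq_zero_iff _ (RatFunc.algebraMap_injective F)] at h1
  have h0 := congrArg (fun f => Polynomial.coeff f 0) h1
  have h2 := congrArg (fun f => Polynomial.coeff f 1) h1
  have h3 := congrArg (fun f => Polynomial.coeff f 2) h1
  have h4 := congrArg (fun f => Polynomial.coeff f 3) h1
  simp [Polynomial.coeff_X, Polynomial.coeff_C, Polynomial.coeff_X_pow] at h0 h2 h3 h4
  exact ⟨h0, h2, h3, h4⟩

/-- The null line attached to a point and a line of the plane, first colour. -/
noncomputable def redLine (q : F × F × F) : RatFunc F × RatFunc F × RatFunc F :=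
  (RatFunc.C q.1 + RatFunc.X ^ 2, RatFunc.C q.2.1 * RatFunc.X + RatFunc.X ^ 2, -RatFunc.C q.2.2)

/-- The null line attached to a point and a line of the plane, second colour. -/
noncomputable def blueLine (q : F × F × F) : RatFunc F × RatFunc F × RatFunc F :=
  (RatFunc.C q.1 * RatFunc.X⁻¹, RatFunc.C q.2.1,
    -RatFunc.C q.2.2 + RatFunc.C q.2.1 * RatFunc.X ^ 2 - RatFunc.C q.1 * RatFunc.X)

theorem lineForm_redLine_blueLine (q r : F × F × F) :
    lineForm (redLine q) (blueLine r) = 0 ↔ r.2.1 * q.1 + r.2.2 = q.2.1 * r.1 + q.2.2 := by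
  have hX : (RatFunc.X : RatFunc F) ≠ 0 := RatFunc.X_ne_zero
  have h : lineForm (redLine q) (blueLine r) =
      RatFunc.C ((r.2.1 * q.1 + r.2.2) - (q.2.1 * r.1 + q.2.2)) := by
    simp only [lineForm, redLine, blueLine, map_add, map_sub, map_mul]
    field_simp
    ring
  rw [h, map_eq_zero, sub_eq_zero]

theorem eq_of_lineForm_redLine {q r : F × F × F} (h : lineForm (redLine q) (redLine r) = 0) :
    q = r := by
  obtain ⟨h1, -, h3, h4⟩ := ratFunc_cubic_eq_zero (a := r.2.2 - q.2.2)
    (b := q.1 * r.2.1 - r.1 * q.2.1) (c := q.1 - r.1) (d := r.2.1 - q.2.1) (by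
      rw [← h]
      simp only [lineForm, redLine, map_sub, map_mul]
      ring)
  exact Prod.ext (sub_eq_zero.1 h3) (Prod.ext (sub_eq_zero.1 h4).symm (sub_eq_zero.1 h1).symm)

theorem eq_of_lineForm_blueLine {q r : F × F × F} (h : lineForm (blueLine q) (blueLine r) = 0) :
    q = r := by
  have hX : (RatFunc.X : RatFunc F) ≠ 0 := RatFunc.X_ne_zero
  obtain ⟨-, h2, h3, h4⟩ := ratFunc_cubic_eq_zero (a := q.1 * r.2.1 - r.1 * q.2.1)
    (b := r.2.2 - q.2.2) (c := r.1 - q.1) (d := q.2.1 - r.2.1) (by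
      rw [← mul_zero RatFunc.X, ← h]
      simp only [lineForm, blueLine, map_sub, map_mul]
      field_simp
      ring)
  exact Prod.ext (sub_eq_zero.1 h3).symm (Prod.ext (sub_eq_zero.1 h4) (sub_eq_zero.1 h2).symm)

theorem redLine_fst_ne_blueLine_fst (q r : F × F × F) : (redLine q).1 ≠ (blueLine r).1 := by
  have hX : (RatFunc.X : RatFunc F) ≠ 0 := RatFunc.X_ne_zero
  intro h
  simp only [redLine, blueLine] at h
  field_simp at h
  obtain ⟨-, -, -, h4⟩ := ratFunc_cubic_eq_zero (a := -r.1) (b := q.1) (c := 0) (d := 1) (by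
    simp only [map_neg, map_zero, map_one]
    linear_combination h)
  exact one_ne_zero h4

theorem redLine_injective : Function.Injective (redLine (F := F)) := fun q r h =>
  eq_of_lineForm_redLine (by rw [h, lineForm]; ring)

theorem blueLine_injective : Function.Injective (blueLine (F := F)) := fun q r h =>
  eq_of_lineForm_blueLine (by rw [h, lineForm]; ring)

open Classical in
theorem isDisjointPair_lift [DecidableEq F] (A : Finset F) (L : Finset (F × F)) (κ : ℕ)
    (hκ : ∀ u v, (L.filter fun l => l.1 * u + l.2 = v).card ≤ κ) :
    IsDisjointPair (max A.card κ) ((A ×ˢ L).image redLine) ((A ×ˢ L).image blueLine) where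
  red r hr r' hr' hne := by
    obtain ⟨q, -, rfl⟩ := mem_image.1 hr
    obtain ⟨q', -, rfl⟩ := mem_image.1 hr'
    exact fun h => hne (congrArg _ (eq_of_lineForm_redLine h))
  blue r hr r' hr' hne := by
    obtain ⟨q, -, rfl⟩ := mem_image.1 hr
    obtain ⟨q', -, rfl⟩ := mem_image.1 hr'
    exact fun h => hne (congrArg _ (eq_of_lineForm_blueLine h))
  slope r hr b hb := by
    obtain ⟨q, -, rfl⟩ := mem_image.1 hr
    obtain ⟨q', -, rfl⟩ := mem_image.1 hb
    exact redLine_fst_ne_blueLine_fst q q'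
  common r hr r' hr' hne := by
    obtain ⟨q, -, rfl⟩ := mem_image.1 hr
    obtain ⟨q', -, rfl⟩ := mem_image.1 hr'
    have hqq : q ≠ q' := fun h => hne (congrArg _ h)
    rw [filter_image, card_image_of_injective _ blueLine_injective]
    simp only [lineForm_redLine_blueLine]
    by_cases h1 : q.1 = q'.1
    · refine le_max_of_le_right ((card_le_card_of_injOn Prod.snd (t := L.filter fun l =>
        l.1 * q.1 + l.2 = q.2.1 * ((q'.2.2 - q.2.2) / (q.2.1 - q'.2.1)) + q.2.2) ?_ ?_).trans
        (hκ _ _))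
      all_goals
        have hs : ∀ b : F × F × F, (b.2.1 * q.1 + b.2.2 = q.2.1 * b.1 + q.2.2 ∧
            b.2.1 * q'.1 + b.2.2 = q'.2.1 * b.1 + q'.2.2) →
            b.1 = (q'.2.2 - q.2.2) / (q.2.1 - q'.2.1) := by
          rintro b ⟨e1, e2⟩
          rw [← h1] at e2
          have e3 : b.1 * (q.2.1 - q'.2.1) = q'.2.2 - q.2.2 := by linear_combination e2 - e1
          rw [eq_div_iff _, e3]
          intro h0
          rw [h0, mul_zero] at e3
          exact hqq (Prod.ext h1 (Prod.ext (sub_eq_zero.1 h0) (sub_eq_zero.1 e3.symm).symm))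
      · intro b hb
        obtain ⟨hb1, hb2⟩ := mem_filter.1 hb
        exact mem_filter.2 ⟨(mem_product.1 hb1).2, by rw [← hs b hb2]; exact hb2.1⟩
      · intro b hb b' hb' hbb
        exact Prod.ext ((hs b (mem_filter.1 hb).2).trans (hs b' (mem_filter.1 hb').2).symm) hbb
    · refine le_max_of_le_left (card_le_card_of_injOn Prod.fst ?_ ?_)
      · exact fun b hb => (mem_product.1 (mem_filter.1 hb).1).1
      · intro b hb b' hb' hbb
        obtain ⟨e1, e2⟩ := (mem_filter.1 hb).2
        obtain ⟨f1, f2⟩ := (mem_filter.1 hb').2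
        have h2 : b.2.1 = b'.2.1 := by
          apply mul_right_cancel₀ (sub_ne_zero.2 h1)
          linear_combination e1 - e2 - f1 + f2 + (q.2.1 - q'.2.1) * hbb
        refine Prod.ext hbb (Prod.ext h2 ?_)
        linear_combination e1 - f1 + q.2.1 * hbb - q.1 * h2

open Classical in
theorem crossings_lift [DecidableEq F] (A : Finset F) (L : Finset (F × F)) :
    crossings ((A ×ˢ L).image redLine) ((A ×ˢ L).image blueLine) =
      (((A ×ˢ L) ×ˢ (A ×ˢ L)).filter fun q =>
        q.1.2.1 * q.1.1 + q.1.2.2 = q.2.2.1 * q.2.1 + q.2.2.2).card := by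
  rw [crossings, sum_image redLine_injective.injOn]
  simp only [filter_image, card_image_of_injective _ blueLine_injective,
    lineForm_redLine_blueLine]
  have h1 : ∀ P : (F × F × F) → (F × F × F) → Prop, ∀ [∀ a, DecidablePred (P a)],
      ∑ a ∈ A ×ˢ L, ((A ×ˢ L).filter (P a)).card =
      (((A ×ˢ L) ×ˢ (A ×ˢ L)).filter fun q => P q.1 q.2).card := by
    intro P _
    simp only [card_filter]
    rw [sum_product (A ×ˢ L) (A ×ˢ L)]
  rw [h1]
  refine card_bij' (fun q _ => ((q.1.1, q.2.2), (q.2.1, q.1.2)))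
    (fun q _ => ((q.1.1, q.2.2), (q.2.1, q.1.2))) ?_ ?_ (fun _ _ => rfl) (fun _ _ => rfl)
  · rintro ⟨⟨a, l⟩, ⟨a', l'⟩⟩ h
    simp only [mem_filter, mem_product] at h ⊢
    tauto
  · rintro ⟨⟨a, l⟩, ⟨a', l'⟩⟩ h
    simp only [mem_filter, mem_product] at h ⊢
    tauto

end Lifting

/-- An incidence bound for cartesian products and lines over a prime field. -/
theorem exists_cartesian_incidence_bound {η : ℝ} (hη : 0 < η) (hη1 : η ≤ 1) :
    ∃ C : ℝ, 0 < C ∧ ∀ (p : ℕ) [Fact p.Prime] (A B : Finset (ZMod p))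
      (L : Finset (ZMod p × ZMod p)) (N₀ κ : ℕ), 2 * (A.card * L.card) ≤ N₀ → N₀ ≤ p ^ 2 →
      A.card ^ 2 ≤ N₀ → κ ^ 2 ≤ N₀ →
      (∀ u v, (L.filter fun l => l.1 * u + l.2 = v).card ≤ κ) →
      (((A ×ˢ L).filter fun q => q.2.1 * q.1 + q.2.2 ∈ B).card : ℝ) ^ 2 ≤
        B.card * (C * (N₀ : ℝ) ^ (3 / 2 + η)) := by
  classical
  obtain ⟨C, hC, h⟩ := exists_crossings_bound hη hη1
  refine ⟨C, hC, fun p _ A B L N₀ κ hAL hp hA hκ hconc => ?_⟩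
  have h1 := h (RatFunc (ZMod p)) p N₀ (max A.card κ)
    (by rcases max_choice A.card κ with h | h <;> rw [h] <;> assumption) hp
    ((A ×ˢ L).image redLine) ((A ×ˢ L).image blueLine) (by
      rw [card_image_of_injective _ redLine_injective,
        card_image_of_injective _ blueLine_injective, card_product]
      omega) (isDisjointPair_lift A L κ hconc)
  rw [crossings_lift] at h1
  have h2 := card_sq_le_card_mul_card_fibres
    ((A ×ˢ L).filter fun q => q.2.1 * q.1 + q.2.2 ∈ B) (fun q => q.2.1 * q.1 + q.2.2) B
    fun q hq => (mem_filter.1 hq).2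
  have h3 : ((((A ×ˢ L).filter fun q => q.2.1 * q.1 + q.2.2 ∈ B) ×ˢ
      ((A ×ˢ L).filter fun q => q.2.1 * q.1 + q.2.2 ∈ B)).filter fun q =>
        q.1.2.1 * q.1.1 + q.1.2.2 = q.2.2.1 * q.2.1 + q.2.2.2).card ≤
      (((A ×ˢ L) ×ˢ (A ×ˢ L)).filter fun q =>
        q.1.2.1 * q.1.1 + q.1.2.2 = q.2.2.1 * q.2.1 + q.2.2.2).card :=
    card_le_card (filter_subset_filter _ (product_subset_product (filter_subset _ _)
      (filter_subset _ _)))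
  have h4 : (((A ×ˢ L).filter fun q => q.2.1 * q.1 + q.2.2 ∈ B).card : ℝ) ^ 2 ≤
      B.card * (((A ×ˢ L) ×ˢ (A ×ˢ L)).filter fun q =>
        q.1.2.1 * q.1.1 + q.1.2.2 = q.2.2.1 * q.2.1 + q.2.2.2).card := by
    exact_mod_cast h2.trans (Nat.mul_le_mul_left _ h3)
  exact h4.trans (by gcongr)

theorem card_pairs_same_key_le {α β : Type*} [DecidableEq β] (W : Finset α) (key : α → β) (cls : α → ℕ) (I : ℕ)
    (hcls : ∀ w ∈ W, cls w < I) :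
    ((W ×ˢ W).filter fun q => key q.1 = key q.2).card ≤
      I * ((W ×ˢ W).filter fun q => key q.1 = key q.2 ∧ cls q.1 = cls q.2).card := by
  have hfib : ∀ (P : α × α → Prop) [DecidablePred P],
      ((W ×ˢ W).filter fun q => key q.1 = key q.2 ∧ P q).card = ∑ v ∈ W.image key,
        (((W.filter fun w => key w = v) ×ˢ (W.filter fun w => key w = v)).filter P).card := by
    intro P _
    rw [card_eq_sum_card_fiberwise (f := fun q : α × α => key q.1) (t := W.image key) fun q hq =>
      mem_image_of_mem _ (mem_product.1 (mem_filter.1 hq).1).1]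
    refine sum_congr rfl fun v _ => ?_
    congr 1
    ext ⟨a, b⟩
    simp only [mem_filter, mem_product]
    constructor
    · rintro ⟨⟨⟨ha, hb⟩, hab, hP⟩, hv⟩
      exact ⟨⟨⟨ha, hv⟩, hb, hab ▸ hv⟩, hP⟩
    · rintro ⟨⟨⟨ha, hv⟩, hb, hv'⟩, hP⟩
      exact ⟨⟨⟨ha, hb⟩, hv.trans hv'.symm, hP⟩, hv⟩
  have h1 := hfib fun _ => True
  simp only [and_true, filter_true] at h1
  rw [h1, hfib fun q => cls q.1 = cls q.2, mul_sum]
  refine sum_le_sum fun v _ => ?_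
  have h2 := card_sq_le_card_mul_card_fibres (W.filter fun w => key w = v) cls (range I)
    fun w hw => mem_range.2 (hcls w (mem_filter.1 hw).1)
  rw [card_product, ← sq]
  rw [card_range] at h2
  exact h2

/-- `x` and `y` are opposite vertices of a proper rectangle with vertices in `E`, in the system of
coordinates given by `T` and `S`. -/
def IsOpp {P V : Type*} (E : Finset P) (T S : P → V) (x y : P) : Prop :=
  T x ≠ T y ∧ S x ≠ S y ∧ (∃ b ∈ E, T b = T x ∧ S b = S y) ∧ ∃ d ∈ E, T d = T y ∧ S d = S x

theorem IsOpp.symm {P V : Type*} {E : Finset P} {T S : P → V} {x y : P} (h : IsOpp E T S x y) :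
    IsOpp E T S y x := ⟨h.1.symm, h.2.1.symm, h.2.2.2, h.2.2.1⟩

theorem isOpp_swap {P V : Type*} {E : Finset P} {T S : P → V} {x y : P} :
    IsOpp E S T x y ↔ IsOpp E T S x y := by
  simp only [IsOpp]
  constructor
  · rintro ⟨h1, h2, ⟨b, hb, h3, h4⟩, d, hd, h5, h6⟩
    exact ⟨h2, h1, ⟨d, hd, h6, h5⟩, b, hb, h4, h3⟩
  · rintro ⟨h1, h2, ⟨b, hb, h3, h4⟩, d, hd, h5, h6⟩
    exact ⟨h2, h1, ⟨d, hd, h6, h5⟩, b, hb, h4, h3⟩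

/-- A pencil of coordinate systems such that two points lie on a common `T`-line for at most one
parameter. -/
structure IsPencil {M P V : Type*} (Ms : Finset M) (T S : M → P → V) : Prop where
  ext : ∀ m ∈ Ms, ∀ x y, T m x = T m y → S m x = S m y → x = y
  unique : ∀ m ∈ Ms, ∀ m' ∈ Ms, ∀ x y, x ≠ y → T m x = T m y → T m' x = T m' y → m = m'

open Classical in
theorem IsPencil.card_collinear_pairs_le {M P V : Type*} {Ms : Finset M} {T S : M → P → V}
    (h : IsPencil Ms T S) (E : Finset P) :
    ((Ms ×ˢ E ×ˢ E).filter fun q => q.2.1 ≠ q.2.2 ∧ T q.1 q.2.1 = T q.1 q.2.2).card ≤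
      E.card ^ 2 := by
  rw [sq, ← card_product]
  refine card_le_card_of_injOn Prod.snd ?_ ?_
  · exact fun q hq => (mem_product.1 (mem_filter.1 hq).1).2
  · rintro ⟨m, q⟩ hq ⟨m', q'⟩ hq' (rfl : q = q')
    obtain ⟨h1, h2, h3⟩ := mem_filter.1 hq
    obtain ⟨h1', -, h3'⟩ := mem_filter.1 hq'
    exact Prod.ext (h.unique m (mem_product.1 h1).1 m' (mem_product.1 h1').1 _ _ h2 h3 h3') rfl

open Classical in
/-- Symmetrisation: up to the number of classes, one may assume that opposite vertices lie on
`T`-lines of the same class. -/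
theorem IsPencil.card_opp_le {M P V : Type*} {Ms : Finset M} {T S : M → P → V}
    (h : IsPencil Ms T S) (E : Finset P) (ct f : M → P → ℕ) (I : ℕ)
    (hct : ∀ m, ∀ x ∈ E, ct m x < I) (hctT : ∀ m x y, T m x = T m y → ct m x = ct m y)
    (hfS : ∀ m x y, S m x = S m y → f m x = f m y) :
    ((Ms ×ˢ E ×ˢ E).filter fun q =>
      IsOpp E (T q.1) (S q.1) q.2.1 q.2.2 ∧ f q.1 q.2.1 = f q.1 q.2.2).card ≤
    I * (E.card ^ 2 + ((Ms ×ˢ E ×ˢ E).filter fun q =>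
      IsOpp E (T q.1) (S q.1) q.2.1 q.2.2 ∧ f q.1 q.2.1 = f q.1 q.2.2 ∧
        ct q.1 q.2.1 = ct q.1 q.2.2).card) := by
  set W := (Ms ×ˢ E ×ˢ E).filter fun q =>
    (q.2.1 ≠ q.2.2 ∧ T q.1 q.2.1 = T q.1 q.2.2) ∧ f q.1 q.2.1 = f q.1 q.2.2 with hW
  have hWcard : W.card ≤ E.card ^ 2 := by
    refine (card_le_card fun q hq => ?_).trans (h.card_collinear_pairs_le E)
    exact mem_filter.2 ⟨(mem_filter.1 hq).1, (mem_filter.1 hq).2.1⟩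
  have h1 := card_pairs_same_key_le W (fun q => (q.1, S q.1 q.2.1, S q.1 q.2.2))
    (fun q => ct q.1 q.2.1) I fun q hq =>
      hct _ _ (mem_product.1 (mem_product.1 (mem_filter.1 hq).1).2).1
  have memW : ∀ m x d, (m, x, d) ∈ W ↔
      (m ∈ Ms ∧ x ∈ E ∧ d ∈ E) ∧ (x ≠ d ∧ T m x = T m d) ∧ f m x = f m d := by
    intro m x d
    simp only [hW, mem_filter, mem_product]
  refine (?_ : _ ≤ _).trans (h1.trans (Nat.mul_le_mul_left _ ?_))
  · refine (card_le_card (t := ((W ×ˢ W).filter _).image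
      fun q => (q.1.1, q.1.2.1, q.2.2.2)) ?_).trans card_image_le
    rintro ⟨m, x, y⟩ hq
    simp only [mem_filter, mem_product] at hq
    obtain ⟨⟨hm, hx, hy⟩, ⟨hT, hS, ⟨b, hb, hb1, hb2⟩, d, hd, hd1, hd2⟩, hf⟩ := hq
    refine mem_image.2 ⟨((m, x, b), (m, d, y)), ?_, rfl⟩
    rw [mem_filter, mem_product, memW, memW]
    refine ⟨⟨⟨⟨hm, hx, hb⟩, ⟨?_, hb1.symm⟩, hf.trans (hfS _ _ _ hb2).symm⟩, ⟨hm, hd, hy⟩,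
      ⟨?_, hd1⟩, (hfS _ _ _ hd2).trans hf⟩, ?_⟩
    · rintro rfl; exact hS hb2
    · rintro rfl; exact hS hd2.symm
    · simp only [hd2, hb2]
  · set Z := (W ×ˢ W).filter fun q => (q.1.1, S q.1.1 q.1.2.1, S q.1.1 q.1.2.2) =
      (q.2.1, S q.2.1 q.2.2.1, S q.2.1 q.2.2.2) ∧ ct q.1.1 q.1.2.1 = ct q.2.1 q.2.2.1
    rw [← card_filter_add_card_filter_not (s := Z) fun q => q.1 = q.2]
    gcongr
    · refine le_trans (card_le_card_of_injOn Prod.fst (t := W) ?_ ?_) hWcard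
      · exact fun q hq => (mem_product.1 (mem_filter.1 (mem_filter.1 hq).1).1).1
      · intro q hq q' hq' hqq
        have h2 := (mem_filter.1 hq).2
        have h3 := (mem_filter.1 hq').2
        exact Prod.ext hqq (by rw [← h2, ← h3]; exact hqq)
    · refine card_le_card_of_injOn (fun q => (q.1.1, q.1.2.1, q.2.2.2)) ?_ ?_
      · rintro ⟨⟨m, x, b⟩, ⟨m', d, y⟩⟩ hq
        rw [mem_coe, mem_filter, mem_filter, mem_product, memW, memW] at hq
        simp only [Prod.mk.injEq] at hq
        obtain ⟨⟨⟨⟨⟨hm, hx, hb⟩, ⟨hxb, hT1⟩, hf1⟩, ⟨-, hd, hy⟩, ⟨hdy, hT2⟩, hf2⟩,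
          ⟨rfl, hS1, hS2⟩, hc⟩, hne⟩ := hq
        refine mem_filter.2 ⟨mem_product.2 ⟨hm, mem_product.2 ⟨hx, hy⟩⟩, ⟨?_, ?_,
          ⟨b, hb, hT1.symm, hS2⟩, d, hd, hT2, hS1.symm⟩, ?_, ?_⟩
        · intro hT
          apply hne
          rw [h.ext m hm x d (hT.trans hT2.symm) hS1, h.ext m hm b y (hT1.symm.trans hT) hS2]
          simp
        · intro hS
          exact hxb (h.ext m hm x b hT1 (hS.trans hS2.symm))
        · exact hf1.trans (hfS _ _ _ hS2)
        · exact hc.trans (hctT _ _ _ hT2)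
      · rintro ⟨⟨m, x, b⟩, ⟨m', d, y⟩⟩ hq ⟨⟨n, x', b'⟩, ⟨n', d', y'⟩⟩ hq' hqq
        rw [mem_coe, mem_filter, mem_filter, mem_product, memW, memW] at hq hq'
        simp only [Prod.mk.injEq] at hq hq' hqq
        obtain ⟨⟨⟨⟨⟨hm, hx, hb⟩, ⟨hxb, hT1⟩, hf1⟩, ⟨-, hd, hy⟩, ⟨hdy, hT2⟩, hf2⟩,
          ⟨rfl, hS1, hS2⟩, hc⟩, hne⟩ := hq
        obtain ⟨⟨⟨⟨⟨-, hx', hb'⟩, ⟨hxb', hT1'⟩, hf1'⟩, ⟨-, hd', hy'⟩, ⟨hdy', hT2'⟩, hf2'⟩,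
          ⟨rfl, hS1', hS2'⟩, hc'⟩, hne'⟩ := hq'
        obtain ⟨rfl, rfl, rfl⟩ := hqq
        rw [h.ext m hm b b' (hT1.symm.trans hT1') (hS2.trans hS2'.symm),
          h.ext m hm d d' (hT2.trans hT2'.symm) (hS1.symm.trans hS1')]

section Slopes
variable {F : Type*} [Field F]

/-- The lines `slopeT m = const` are the lines of slope `m`. -/
def slopeT (m : F) (x : F × F) : F := x.2 - m * x.1

/-- The lines `slopeS m = const` are orthogonal to the lines of slope `m`. -/
def slopeS (m : F) (x : F × F) : F := x.1 + m * x.2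

/-- The point with given coordinates with respect to `slopeT m` and `slopeS m`. -/
def slopePt (m t s : F) : F × F := ((s - m * t) / (1 + m ^ 2), (t + m * s) / (1 + m ^ 2))

variable (hF : ∀ m : F, 1 + m ^ 2 ≠ 0)
include hF

theorem slopeT_slopePt (m t s : F) : slopeT m (slopePt m t s) = t := by
  have := hF m
  simp only [slopeT, slopePt]
  field_simp
  ring

theorem slopeS_slopePt (m t s : F) : slopeS m (slopePt m t s) = s := by
  have := hF m
  simp only [slopeS, slopePt]
  field_simp
  ring

theorem eq_of_slopes_eq {m : F} {x y : F × F} (h1 : slopeT m x = slopeT m y)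
    (h2 : slopeS m x = slopeS m y) : x = y := by
  simp only [slopeT, slopeS] at h1 h2
  refine Prod.ext ?_ ?_
  · apply mul_left_cancel₀ (hF m)
    linear_combination h2 - m * h1
  · apply mul_left_cancel₀ (hF m)
    linear_combination h1 + m * h2

theorem isPencil_slope (Ms : Finset F) : IsPencil Ms slopeT slopeS where
  ext m _ x y := eq_of_slopes_eq hF
  unique m _ m' _ x y hne h1 h2 := by
    simp only [slopeT] at h1 h2
    have h3 : x.1 - y.1 ≠ 0 := by
      intro h3
      exact hne (Prod.ext (sub_eq_zero.1 h3) (by linear_combination h1 + m * h3))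
    apply mul_right_cancel₀ h3
    linear_combination h2 - h1

theorem isPencil_slope_swap (Ms : Finset F) : IsPencil Ms slopeS slopeT where
  ext m _ x y h1 h2 := eq_of_slopes_eq hF h2 h1
  unique m _ m' _ x y hne h1 h2 := by
    simp only [slopeS] at h1 h2
    have h3 : x.2 - y.2 ≠ 0 := by
      intro h3
      exact hne (Prod.ext (by linear_combination h1 - m * h3) (sub_eq_zero.1 h3))
    apply mul_right_cancel₀ h3
    linear_combination h1 - h2

omit hF

theorem slopeT_neg_inv_eq_iff {m : F} (hm : m ≠ 0) (x y : F × F) :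
    slopeT (-m⁻¹) x = slopeT (-m⁻¹) y ↔ slopeS m x = slopeS m y := by
  have h : ∀ z : F × F, slopeT (-m⁻¹) z = m⁻¹ * slopeS m z := fun z => by
    simp only [slopeT, slopeS]; field_simp; ring
  rw [h, h, mul_right_inj' (inv_ne_zero hm)]

theorem slopeS_neg_inv_eq_iff {m : F} (hm : m ≠ 0) (x y : F × F) :
    slopeS (-m⁻¹) x = slopeS (-m⁻¹) y ↔ slopeT m x = slopeT m y := by
  have h : ∀ z : F × F, slopeS (-m⁻¹) z = -m⁻¹ * slopeT m z := fun z => by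
    simp only [slopeT, slopeS]; field_simp; ring
  rw [h, h, mul_right_inj' (neg_ne_zero.2 (inv_ne_zero hm))]

variable [DecidableEq F]

/-- The number of points of `E` on the line of slope `m` through `x`. -/
def rowT (E : Finset (F × F)) (m : F) (x : F × F) : ℕ :=
  (E.filter fun z => slopeT m z = slopeT m x).card

/-- The number of points of `E` on the line orthogonal to slope `m` through `x`. -/
def rowS (E : Finset (F × F)) (m : F) (x : F × F) : ℕ :=
  (E.filter fun z => slopeS m z = slopeS m x).card

variable [Fintype F]

open Classical in
/-- Parameters and opposite vertices of the rectangles with sides not parallel to the axes. -/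
noncomputable def oppSet (E : Finset (F × F)) : Finset (F × (F × F) × (F × F)) :=
  (univ.filter fun m : F => m ≠ 0) ×ˢ E ×ˢ E |>.filter fun q =>
    IsOpp E (slopeT q.1) (slopeS q.1) q.2.1 q.2.2

/-- The part of `oppSet` where both sides through each of the two vertices lie in dyadic classes
`i` and `j`. -/
noncomputable def oppClass (E : Finset (F × F)) (i j : ℕ) : Finset (F × (F × F) × (F × F)) :=
  (oppSet E).filter fun q => (Nat.log 2 (rowT E q.1 q.2.1) = i ∧ Nat.log 2 (rowT E q.1 q.2.2) = i)
    ∧ Nat.log 2 (rowS E q.1 q.2.1) = j ∧ Nat.log 2 (rowS E q.1 q.2.2) = j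

theorem mem_oppSet {E : Finset (F × F)} {m : F} {x y : F × F} : (m, x, y) ∈ oppSet E ↔
    (m ≠ 0 ∧ x ∈ E ∧ y ∈ E) ∧ IsOpp E (slopeT m) (slopeS m) x y := by
  simp [oppSet]

theorem mem_oppClass {E : Finset (F × F)} {i j : ℕ} {m : F} {x y : F × F} :
    (m, x, y) ∈ oppClass E i j ↔ ((m ≠ 0 ∧ x ∈ E ∧ y ∈ E) ∧ IsOpp E (slopeT m) (slopeS m) x y) ∧
    (Nat.log 2 (rowT E m x) = i ∧ Nat.log 2 (rowT E m y) = i)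
    ∧ Nat.log 2 (rowS E m x) = j ∧ Nat.log 2 (rowS E m y) = j := by
  simp only [oppClass, mem_filter, mem_oppSet]

theorem card_oppClass_swap_le (E : Finset (F × F)) (i j : ℕ) :
    (oppClass E i j).card ≤ (oppClass E j i).card := by
  refine card_le_card_of_injOn (fun q => (-q.1⁻¹, q.2)) ?_ ?_
  · rintro ⟨m, x, y⟩ hq
    rw [mem_coe, mem_oppClass] at hq
    obtain ⟨⟨⟨hm, hx, hy⟩, ho⟩, ⟨h1, h2⟩, h3, h4⟩ := hq
    have e1 : ∀ z, rowT E (-m⁻¹) z = rowS E m z := fun z => by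
      simp only [rowT, rowS, slopeT_neg_inv_eq_iff hm]
    have e2 : ∀ z, rowS E (-m⁻¹) z = rowT E m z := fun z => by
      simp only [rowT, rowS, slopeS_neg_inv_eq_iff hm]
    rw [mem_coe, mem_oppClass, e1, e1, e2, e2]
    refine ⟨⟨⟨neg_ne_zero.2 (inv_ne_zero hm), hx, hy⟩, ?_⟩, ⟨h3, h4⟩, h1, h2⟩
    rw [← isOpp_swap] at ho
    simpa only [IsOpp, slopeT_neg_inv_eq_iff hm, slopeS_neg_inv_eq_iff hm, ne_eq] using ho
  · rintro ⟨m, q⟩ - ⟨m', q'⟩ - h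
    simp only [Prod.mk.injEq, neg_inj, inv_inj] at h
    exact Prod.ext h.1 h.2

include hF in
theorem card_oppSet_le (E : Finset (F × F)) :
    (oppSet E).card ≤ (Nat.log 2 E.card + 1) * (E.card ^ 2 + (Nat.log 2 E.card + 1) *
      (E.card ^ 2 + ∑ i ∈ range (Nat.log 2 E.card + 1), ∑ j ∈ range (Nat.log 2 E.card + 1),
        (oppClass E i j).card)) := by
  classical
  set I := Nat.log 2 E.card + 1 with hI
  have hT : ∀ (m : F), ∀ x ∈ E, Nat.log 2 (rowT E m x) < I := fun m x _ =>
    Nat.lt_succ_of_le (Nat.log_mono_right (card_filter_le _ _))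
  have hS : ∀ (m : F), ∀ x ∈ E, Nat.log 2 (rowS E m x) < I := fun m x _ =>
    Nat.lt_succ_of_le (Nat.log_mono_right (card_filter_le _ _))
  have hTT : ∀ (m : F) (x y : F × F), slopeT m x = slopeT m y →
      Nat.log 2 (rowT E m x) = Nat.log 2 (rowT E m y) := fun m x y h => by
    simp only [rowT, h]
  have hSS : ∀ (m : F) (x y : F × F), slopeS m x = slopeS m y →
      Nat.log 2 (rowS E m x) = Nat.log 2 (rowS E m y) := fun m x y h => by
    simp only [rowS, h]
  have h1 := (isPencil_slope hF (univ.filter fun m : F => m ≠ 0)).card_opp_le E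
    (fun m x => Nat.log 2 (rowT E m x)) (fun _ _ => 0) I hT hTT fun _ _ _ _ => rfl
  have h2 := (isPencil_slope_swap hF (univ.filter fun m : F => m ≠ 0)).card_opp_le E
    (fun m x => Nat.log 2 (rowS E m x)) (fun m x => Nat.log 2 (rowT E m x)) I hS hSS hTT
  have hswap : ∀ (m : F) (x y : F × F), IsOpp E (slopeS m) (slopeT m) x y ↔
      IsOpp E (slopeT m) (slopeS m) x y := fun _ _ _ => isOpp_swap
  simp only [and_true, true_and] at h1
  simp only [hswap] at h2
  rw [oppSet]
  refine (Eq.le (by congr!)).trans (h1.trans ?_)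
  gcongr
  refine (Eq.le (by congr!)).trans (h2.trans ?_)
  gcongr
  rw [← sum_product']
  rw [card_eq_sum_card_fiberwise (f := fun q =>
    (Nat.log 2 (rowT E q.1 q.2.1), Nat.log 2 (rowS E q.1 q.2.1))) (t := range I ×ˢ range I)]
  · refine sum_le_sum fun ij _ => card_le_card ?_
    rintro ⟨m, x, y⟩ hq
    simp only [mem_filter, mem_product, mem_univ, true_and] at hq
    rw [mem_oppClass]
    obtain ⟨⟨⟨hm, hx, hy⟩, ho, hc, hc'⟩, rfl⟩ := hq
    exact ⟨⟨⟨hm, hx, hy⟩, ho⟩, ⟨rfl, hc.symm⟩, rfl, hc'.symm⟩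
  · rintro ⟨m, x, y⟩ hq
    simp only [coe_filter, mem_product, Set.mem_ofPred_eq] at hq
    simp only [coe_product, Set.mem_prod, mem_coe, mem_range]
    exact ⟨hT m x hq.1.2.1, hS m x hq.1.2.1⟩

end Slopes

theorem one_add_sq_ne_zero_of_mod_four {p : ℕ} [Fact p.Prime] (hp : p % 4 = 3) (m : ZMod p) :
    1 + m ^ 2 ≠ 0 := fun h =>
  ZMod.mod_four_ne_three_of_sq_eq_neg_one (show m ^ 2 = -1 by linear_combination h) hp

theorem eq_zero_of_sq_add_sq {F : Type*} [Field F] (hF : ∀ m : F, 1 + m ^ 2 ≠ 0) {x y : F}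
    (h : x ^ 2 + y ^ 2 = 0) : x = 0 ∧ y = 0 := by
  have hx : x = 0 := by
    by_contra hx
    apply hF (y / x)
    field_simp
    linear_combination h
  subst hx
  exact ⟨rfl, by simpa using h⟩

/-- A non-degenerate rectangle is a proper rectangle when there are no isotropic vectors. -/
theorem IsRectangle.proper {p : ℕ} [Fact p.Prime] (hF : ∀ m : ZMod p, 1 + m ^ 2 ≠ 0)
    {a b c d : Pt p} (h : IsRectangle a b c d)
    (hnd : ¬ Collinear (ZMod p) ({a, b, c, d} : Set (Pt p))) :
    c.1 = b.1 + d.1 - a.1 ∧ c.2 = b.2 + d.2 - a.2 ∧ b ≠ a ∧ d ≠ a ∧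
      (b.1 - a.1) * (d.1 - a.1) + (b.2 - a.2) * (d.2 - a.2) = 0 := by
  obtain ⟨h1, h2, h3, h4⟩ := h
  simp only [IsCorner] at h1 h2 h3 h4
  obtain ⟨e1, e2⟩ := eq_zero_of_sq_add_sq hF (x := c.1 - (b.1 + d.1 - a.1))
    (y := c.2 - (b.2 + d.2 - a.2)) (by linear_combination 2 * h1 + h2 + h3 + h4 - h1)
  have e1' := sub_eq_zero.1 e1
  have e2' := sub_eq_zero.1 e2
  refine ⟨e1', e2', ?_, ?_, h1⟩
  · rintro rfl
    apply hnd
    have : c = d := Prod.ext (by rw [e1']; ring) (by rw [e2']; ring)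
    rw [this]
    simpa using collinear_pair (ZMod p) b d
  · rintro rfl
    apply hnd
    have : c = b := Prod.ext (by rw [e1']; ring) (by rw [e2']; ring)
    rw [this]
    have h5 : ({d, b, b, d} : Set (Pt p)) = {d, b} := by
      ext x; simp only [Set.mem_insert_iff, Set.mem_singleton_iff]; tauto
    rw [h5]
    exact collinear_pair (ZMod p) d b

theorem rectCount_le {p : ℕ} [Fact p.Prime] (hF : ∀ m : ZMod p, 1 + m ^ 2 ≠ 0)
    (E : Finset (Pt p)) : rectCount p E ≤ 2 * E.card ^ 2 + (oppSet E).card := by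
  set U₁ := (E ×ˢ E).image fun q => (q.1, ((q.1.1, q.2.2) : Pt p), q.2, ((q.2.1, q.1.2) : Pt p))
  set U₂ := (E ×ˢ E).image fun q => (q.1, ((q.2.1, q.1.2) : Pt p), q.2, ((q.1.1, q.2.2) : Pt p))
  set U₃ := (oppSet E).image fun q =>
    (q.2.1, (slopePt q.1 (slopeT q.1 q.2.1) (slopeS q.1 q.2.2) : Pt p), q.2.2,
      (slopePt q.1 (slopeT q.1 q.2.2) (slopeS q.1 q.2.1) : Pt p))
  have hcard : (U₁ ∪ U₂ ∪ U₃).card ≤ 2 * E.card ^ 2 + (oppSet E).card := by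
    refine (card_union_le _ _).trans (Nat.add_le_add ((card_union_le _ _).trans ?_) card_image_le)
    have h1 : U₁.card ≤ E.card ^ 2 := card_image_le.trans (by rw [card_product, sq])
    have h2 : U₂.card ≤ E.card ^ 2 := card_image_le.trans (by rw [card_product, sq])
    omega
  refine le_trans ?_ hcard
  rw [rectCount, ← Set.ncard_coe_finset]
  refine Set.ncard_le_ncard ?_ (Finset.finite_toSet _)
  rintro ⟨a, b, c, d⟩ ⟨ha, hb, hc, hd, hr, hnd⟩
  simp only at ha hb hc hd hr hnd
  obtain ⟨e1, e2, hba, hda, horth⟩ := hr.proper hF hnd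
  rw [mem_coe, mem_union, mem_union]
  by_cases h1 : b.1 = a.1
  · refine Or.inl (Or.inl (mem_image.2 ⟨(a, c), mem_product.2 ⟨ha, hc⟩, ?_⟩))
    have h2 : b.2 - a.2 ≠ 0 := fun h2 => hba (Prod.ext h1 (sub_eq_zero.1 h2))
    have h3 : d.2 - a.2 = 0 := by
      apply (mul_eq_zero.1 _).resolve_left h2
      rw [h1] at horth
      linear_combination horth
    have hb' : (a.1, c.2) = b := Prod.ext h1.symm (by simp only; linear_combination e2 + h3)
    have hd' : (c.1, a.2) = d := Prod.ext (by simp only; linear_combination e1 + h1)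
      (by simp only; linear_combination -h3)
    simp only [hb', hd']
  have h1' : b.1 - a.1 ≠ 0 := sub_ne_zero.2 h1
  by_cases h2 : b.2 = a.2
  · refine Or.inl (Or.inr (mem_image.2 ⟨(a, c), mem_product.2 ⟨ha, hc⟩, ?_⟩))
    have h3 : d.1 - a.1 = 0 := by
      apply (mul_eq_zero.1 _).resolve_left h1'
      rw [h2] at horth
      linear_combination horth
    have hb' : (c.1, a.2) = b := Prod.ext (by simp only; linear_combination e1 + h3) h2.symm
    have hd' : (a.1, c.2) = d := Prod.ext (by simp only; linear_combination -h3)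
      (by simp only; linear_combination e2 + h2)
    simp only [hb', hd']
  refine Or.inr ?_
  obtain ⟨m, hm⟩ : ∃ m, m = (b.2 - a.2) / (b.1 - a.1) := ⟨_, rfl⟩
  have hm0 : m ≠ 0 := hm ▸ div_ne_zero (sub_ne_zero.2 h2) h1'
  have hmb : b.2 - a.2 = m * (b.1 - a.1) := by rw [hm]; field_simp
  have hmd : (d.1 - a.1) + m * (d.2 - a.2) = 0 := by
    apply (mul_eq_zero.1 _).resolve_left h1'
    linear_combination horth - (d.2 - a.2) * hmb
  have hTb : slopeT m b = slopeT m a := by simp only [slopeT]; linear_combination hmb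
  have hSd : slopeS m d = slopeS m a := by simp only [slopeS]; linear_combination hmd
  have hSb : slopeS m b = slopeS m c := by
    simp only [slopeS]; rw [e1, e2]; linear_combination -hmd
  have hTd : slopeT m d = slopeT m c := by
    simp only [slopeT]; rw [e1, e2]; linear_combination -hmb
  have hb' : slopePt m (slopeT m a) (slopeS m c) = b :=
    eq_of_slopes_eq hF ((slopeT_slopePt hF _ _ _).trans hTb.symm)
      ((slopeS_slopePt hF _ _ _).trans hSb.symm)
  have hd' : slopePt m (slopeT m c) (slopeS m a) = d :=
    eq_of_slopes_eq hF ((slopeT_slopePt hF _ _ _).trans hTd.symm)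
      ((slopeS_slopePt hF _ _ _).trans hSd.symm)
  refine mem_image.2 ⟨(m, a, c), mem_oppSet.2 ⟨⟨hm0, ha, hc⟩, ?_, ?_, ⟨b, hb, hTb, hSb⟩, d, hd,
    hTd, hSd⟩, ?_⟩
  · exact fun h => hda (eq_of_slopes_eq hF (hTd.trans h.symm) hSd)
  · exact fun h => hba (eq_of_slopes_eq hF hTb (hSb.trans h.symm))
  · simp only [hb', hd']

section RichLines
variable {F : Type*} [Field F] [DecidableEq F] [Fintype F]

/-- The pairs `(m, t)` for which the number of points of `E` on the line of slope `m` and intercept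
`t` lies in the dyadic class `i`. -/
def dyadicLines (E : Finset (F × F)) (i : ℕ) : Finset (F × F) :=
  univ.filter fun l => Nat.log 2 (E.filter fun z => slopeT l.1 z = l.2).card = i

theorem mem_dyadicLines {E : Finset (F × F)} {i : ℕ} {l : F × F} : l ∈ dyadicLines E i ↔
    Nat.log 2 (E.filter fun z => slopeT l.1 z = l.2).card = i := by
  simp [dyadicLines]

theorem two_pow_le_of_log_eq {a i : ℕ} (hi : i ≠ 0) (h : Nat.log 2 a = i) : 2 ^ i ≤ a := by
  subst h
  exact Nat.pow_log_le_self 2 fun h => hi (by simp [h])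

theorem le_two_mul_two_pow_of_log_eq {a i : ℕ} (h : Nat.log 2 a = i) : a ≤ 2 * 2 ^ i := by
  subst h
  have := Nat.lt_pow_succ_log_self (b := 2) (by norm_num) a
  rw [pow_succ] at this
  omega

variable (hF : ∀ m : F, 1 + m ^ 2 ≠ 0)
include hF

theorem card_dyadicLines_mul_le (E : Finset (F × F)) {i : ℕ} (hi : i ≠ 0) :
    (dyadicLines E i).card * (2 ^ i) ^ 2 ≤ 2 * E.card ^ 2 := by
  classical
  have h1 := (isPencil_slope hF univ).card_collinear_pairs_le E
  have h2 : (dyadicLines E i).card * (2 ^ i * (2 ^ i - 1)) ≤ E.card ^ 2 := by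
    refine le_trans ?_ h1
    rw [← smul_eq_mul]
    refine (card_nsmul_le_sum _ (fun l => (E.filter fun z => slopeT l.1 z = l.2).offDiag.card) _
      fun l hl => ?_).trans ?_
    · have h3 := two_pow_le_of_log_eq hi (mem_dyadicLines.1 hl)
      rw [offDiag_card, ← Nat.mul_sub_one]
      gcongr
    · rw [← card_sigma]
      refine card_le_card_of_injOn (fun q => (q.1.1, q.2)) ?_ ?_
      · rintro ⟨⟨m, t⟩, x, y⟩ hq
        simp only [coe_sigma, Set.mem_sigma_iff, mem_coe, mem_offDiag, mem_filter] at hq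
        simp only [coe_filter, mem_product, mem_univ, true_and, Set.mem_ofPred_eq]
        exact ⟨⟨hq.2.1.1, hq.2.2.1.1⟩, hq.2.2.2, hq.2.1.2.trans hq.2.2.1.2.symm⟩
      · rintro ⟨⟨m, t⟩, x, y⟩ hq ⟨⟨m', t'⟩, x', y'⟩ hq' h
        simp only [coe_sigma, Set.mem_sigma_iff, mem_coe, mem_offDiag, mem_filter] at hq hq'
        simp only [Prod.mk.injEq] at h
        obtain ⟨rfl, rfl, rfl⟩ := h
        obtain rfl : t = t' := hq.2.1.2.symm.trans hq'.2.1.2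
        rfl
  have h3 : 2 ≤ 2 ^ i := Nat.le_self_pow hi 2
  have h4 : (2 ^ i) ^ 2 ≤ 2 * (2 ^ i * (2 ^ i - 1)) := by
    obtain ⟨k, hk⟩ := Nat.exists_eq_add_of_le h3
    rw [hk, show 2 + k - 1 = k + 1 by omega]
    nlinarith
  calc _ ≤ (dyadicLines E i).card * (2 * (2 ^ i * (2 ^ i - 1))) := by gcongr
    _ = 2 * ((dyadicLines E i).card * (2 ^ i * (2 ^ i - 1))) := by ring
    _ ≤ _ := by gcongr

theorem card_dyadicLines_through_mul_le (E : Finset (F × F)) {i : ℕ} (hi : i ≠ 0) (x : F × F) :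
    ((dyadicLines E i).filter fun l => slopeT l.1 x = l.2).card * 2 ^ i ≤ 2 * E.card := by
  set R := (dyadicLines E i).filter fun l => slopeT l.1 x = l.2
  have h2 : R.card * (2 ^ i - 1) ≤ E.card := by
    rw [← smul_eq_mul]
    refine (card_nsmul_le_sum _ (fun l => ((E.filter fun z => slopeT l.1 z = l.2).erase x).card) _
      fun l hl => ?_).trans ?_
    · have h3 := two_pow_le_of_log_eq hi (mem_dyadicLines.1 (mem_filter.1 hl).1)
      exact (Nat.sub_le_sub_right h3 1).trans pred_card_le_card_erase
    · rw [← card_sigma]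
      refine card_le_card_of_injOn (fun q => q.2) ?_ ?_
      · rintro ⟨l, z⟩ hq
        simp only [coe_sigma, Set.mem_sigma_iff, mem_coe, mem_erase, mem_filter] at hq
        exact hq.2.2.1
      · rintro ⟨⟨m, t⟩, z⟩ hq ⟨⟨m', t'⟩, z'⟩ hq' h
        simp only [coe_sigma, Set.mem_sigma_iff, mem_coe, mem_erase, mem_filter, R] at hq hq'
        simp only at h
        subst h
        obtain rfl : m = m' := (isPencil_slope hF univ).unique m (mem_univ _) m' (mem_univ _) z x
          hq.2.1 (hq.2.2.2.trans hq.1.2.symm) (hq'.2.2.2.trans hq'.1.2.symm)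
        obtain rfl : t = t' := hq.2.2.2.symm.trans hq'.2.2.2
        rfl
  have h3 : 2 ≤ 2 ^ i := Nat.le_self_pow hi 2
  calc _ ≤ R.card * (2 * (2 ^ i - 1)) := by gcongr; omega
    _ = 2 * (R.card * (2 ^ i - 1)) := by ring
    _ ≤ _ := by gcongr

theorem card_oppClass_le_of_poor (E : Finset (F × F)) (i j : ℕ) :
    (oppClass E i j).card ≤ E.card ^ 2 * (2 * 2 ^ i) := by
  classical
  set Q := ((univ : Finset F) ×ˢ E ×ˢ E).filter fun q =>
    q.2.1 ≠ q.2.2 ∧ slopeS q.1 q.2.1 = slopeS q.1 q.2.2 with hQ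
  have h1 : Q.card ≤ E.card ^ 2 := (Eq.le (by rw [hQ]; congr!)).trans
    ((isPencil_slope_swap hF univ).card_collinear_pairs_le E)
  set Q' := Q.filter fun q => Nat.log 2 (rowT E q.1 q.2.2) = i
  have h2 : oppClass E i j ⊆ Q'.biUnion fun q =>
      (E.filter fun z => slopeT q.1 z = slopeT q.1 q.2.2).image fun y => (q.1, q.2.1, y) := by
    rintro ⟨m, x, y⟩ h
    obtain ⟨⟨⟨-, hx, hy⟩, hT, hS, -, d, hd, hd1, hd2⟩, ⟨-, h3⟩, -⟩ := mem_oppClass.1 h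
    refine mem_biUnion.2 ⟨(m, x, d), mem_filter.2 ⟨mem_filter.2 ⟨?_, ?_, hd2.symm⟩, ?_⟩,
      mem_image.2 ⟨y, mem_filter.2 ⟨hy, hd1.symm⟩, rfl⟩⟩
    · simp [hx, hd]
    · rintro (rfl : x = d); exact hT hd1
    · simpa only [rowT, hd1] using h3
  refine (card_le_card h2).trans ((card_biUnion_le_card_mul _ _ (2 * 2 ^ i) fun q hq => ?_).trans ?_)
  · exact card_image_le.trans (le_two_mul_two_pow_of_log_eq (mem_filter.1 hq).2)
  · gcongr
    exact (card_filter_le _ _).trans h1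

omit hF in
theorem card_oppClass_le_card_dyadicLines (E : Finset (F × F)) (i j : ℕ) :
    (oppClass E i j).card ≤ (dyadicLines E i).card * E.card * (2 * 2 ^ i) := by
  classical
  have h2 : oppClass E i j ⊆ (dyadicLines E i ×ˢ E).biUnion fun q =>
      (E.filter fun z => slopeT q.1.1 z = q.1.2).image fun x => (q.1.1, x, q.2) := by
    rintro ⟨m, x, y⟩ h
    obtain ⟨⟨⟨-, hx, hy⟩, -⟩, ⟨h3, -⟩, -⟩ := mem_oppClass.1 h
    exact mem_biUnion.2 ⟨((m, slopeT m x), y), mem_product.2 ⟨mem_dyadicLines.2 h3, hy⟩,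
      mem_image.2 ⟨x, mem_filter.2 ⟨hx, rfl⟩, rfl⟩⟩
  rw [← card_product]
  refine (card_le_card h2).trans (card_biUnion_le_card_mul _ _ (2 * 2 ^ i) fun q hq => ?_)
  exact card_image_le.trans
    (le_two_mul_two_pow_of_log_eq (mem_dyadicLines.1 (mem_product.1 hq).1))

theorem card_oppClass_mul_le_of_rich (E : Finset (F × F)) {i : ℕ} (hi : i ≠ 0) (j : ℕ) :
    (oppClass E i j).card * 2 ^ i ≤ 4 * E.card ^ 3 := by
  calc _ ≤ (dyadicLines E i).card * E.card * (2 * 2 ^ i) * 2 ^ i := by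
        gcongr; exact card_oppClass_le_card_dyadicLines E i j
    _ = (dyadicLines E i).card * (2 ^ i) ^ 2 * (2 * E.card) := by ring
    _ ≤ 2 * E.card ^ 2 * (2 * E.card) :=
      Nat.mul_le_mul_right _ (card_dyadicLines_mul_le hF E hi)
    _ = _ := by ring

end RichLines

/-- A symmetric relation is small if every flag sees few incidences, counted with multiplicity. -/
theorem card_le_card_mul_of_flags {M P : Type*} [Fintype M] [DecidableEq M] [DecidableEq P]
    (D : Finset (M × P × P)) (E : Finset P) (R : M → P → Prop) [∀ m x, Decidable (R m x)]
    (hsymm : ∀ m x y, (m, x, y) ∈ D → (m, y, x) ∈ D)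
    (hD : ∀ m x y, (m, x, y) ∈ D → y ∈ E ∧ R m y) {B : ℝ} (hB : 0 ≤ B)
    (h : ∀ m y, (((E ×ˢ univ).filter fun q : P × M => (m, q.1, y) ∈ D ∧ R q.2 q.1).card : ℝ) ≤ B) :
    (D.card : ℝ) ≤ E.card * B := by
  set ρ : P → ℝ := fun x => (univ.filter fun m => R m x).card with hρ
  have hpos : ∀ m x, R m x → 0 < ρ x := fun m x hm => by
    simp only [hρ, Nat.cast_pos]
    exact card_pos.2 ⟨m, mem_filter.2 ⟨mem_univ _, hm⟩⟩
  have hsw : ∑ q ∈ D, ρ q.2.2 / ρ q.2.1 = ∑ q ∈ D, ρ q.2.1 / ρ q.2.2 :=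
    sum_bij' (fun q _ => (q.1, q.2.2, q.2.1)) (fun q _ => (q.1, q.2.2, q.2.1))
      (fun q hq => hsymm _ _ _ hq) (fun q hq => hsymm _ _ _ hq) (fun _ _ => rfl) (fun _ _ => rfl)
      fun _ _ => rfl
  have h1 : (D.card : ℝ) ≤ ∑ q ∈ D, ρ q.2.1 / ρ q.2.2 := by
    have h2 : (2 : ℝ) * D.card ≤ ∑ q ∈ D, (ρ q.2.1 / ρ q.2.2 + ρ q.2.2 / ρ q.2.1) := by
      rw [mul_comm, ← nsmul_eq_mul]
      refine card_nsmul_le_sum _ _ _ fun q hq => ?_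
      have hy := hpos _ _ (hD q.1 q.2.1 q.2.2 hq).2
      have hx := hpos _ _ (hD q.1 q.2.2 q.2.1 (hsymm _ _ _ hq)).2
      rw [div_add_div _ _ hy.ne' hx.ne', le_div_iff₀ (mul_pos hy hx)]
      nlinarith [sq_nonneg (ρ q.2.1 - ρ q.2.2)]
    rw [sum_add_distrib, hsw] at h2
    linarith
  refine h1.trans ?_
  have h3 : ∑ q ∈ D, ρ q.2.1 / ρ q.2.2 =
      ∑ y ∈ E, ∑ m ∈ univ.filter fun m => R m y,
        ((((E ×ˢ univ).filter fun q : P × M => (m, q.1, y) ∈ D ∧ R q.2 q.1).card : ℝ) / ρ y) := by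
    rw [← sum_fiberwise_of_maps_to (g := fun q : M × P × P => q.2.2) (t := E)
      fun q hq => (hD q.1 q.2.1 q.2.2 hq).1]
    refine sum_congr rfl fun y _ => ?_
    rw [← sum_fiberwise_of_maps_to (g := fun q : M × P × P => q.1)
      (t := univ.filter fun m => R m y) fun q hq => ?_]
    · refine sum_congr rfl fun m _ => ?_
      rw [filter_filter]
      have h4 : ∀ q ∈ D.filter (fun q => q.2.2 = y ∧ q.1 = m), ρ q.2.1 / ρ q.2.2 = ρ q.2.1 / ρ y :=
        fun q hq => by rw [(mem_filter.1 hq).2.1]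
      rw [sum_congr rfl h4, ← sum_div]
      congr 1
      simp only [hρ]
      rw [← Nat.cast_sum, ← card_sigma]
      congr 1
      refine card_bij' (fun q _ => (q.1.2.1, q.2)) (fun q _ => ⟨(m, q.1, y), q.2⟩) ?_ ?_ ?_ ?_
      · rintro ⟨⟨m', x, y'⟩, m''⟩ hq
        simp only [mem_sigma, mem_filter, mem_univ, true_and] at hq
        obtain ⟨⟨hq, rfl, rfl⟩, hr⟩ := hq
        simp only [mem_filter, mem_product, mem_univ, and_true]
        exact ⟨(hD _ _ _ (hsymm _ _ _ hq)).1, hq, hr⟩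
      · rintro ⟨x, m''⟩ hq
        simp only [mem_filter, mem_product, mem_univ, and_true] at hq
        simp only [mem_sigma, mem_filter, mem_univ, true_and, and_true]
        exact hq.2
      · rintro ⟨⟨m', x, y'⟩, m''⟩ hq
        simp only [mem_sigma, mem_filter, mem_univ, true_and] at hq
        obtain ⟨⟨hq, rfl, rfl⟩, hr⟩ := hq
        rfl
      · rintro ⟨x, m''⟩ hq
        rfl
    · obtain ⟨hqD, hqy⟩ := mem_filter.1 hq
      exact mem_filter.2 ⟨mem_univ _, hqy ▸ (hD q.1 q.2.1 q.2.2 hqD).2⟩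
  rw [h3, ← nsmul_eq_mul]
  refine sum_le_card_nsmul _ _ _ fun y _ => ?_
  rcases (univ.filter fun m => R m y).eq_empty_or_nonempty with h0 | ⟨m₀, hm₀⟩
  · rw [h0, sum_empty]; exact hB
  · have hy := hpos _ _ (mem_filter.1 hm₀).2
    refine (sum_le_card_nsmul _ _ (B / ρ y) fun m _ => ?_).trans (le_of_eq ?_)
    · gcongr
      exact h m y
    · rw [nsmul_eq_mul]
      change ρ y * (B / ρ y) = B
      field_simp

section LineChange
variable {F : Type*} [Field F]

/-- The line of slope `l.1` and intercept `l.2`, expressed as a graph in the coordinates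
`slopeT m` and `slopeS m`. -/
def changeLine (m : F) (l : F × F) : F × F :=
  (-(1 + m * l.1) / (m - l.1), (1 + m ^ 2) * l.2 / (m - l.1))

theorem changeLine_mul_add {m m' : F} (h : m' ≠ m) (x : F × F) :
    (changeLine m (m', slopeT m' x)).1 * slopeT m x + (changeLine m (m', slopeT m' x)).2 =
      slopeS m x := by
  have h' : m - m' ≠ 0 := sub_ne_zero.2 h.symm
  simp only [changeLine, slopeT, slopeS]
  field_simp
  ring

variable (hF : ∀ m : F, 1 + m ^ 2 ≠ 0)
include hF

theorem slopeT_slopePt_of_changeLine {m : F} {l : F × F} (h : l.1 ≠ m) {u v : F}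
    (hl : (changeLine m l).1 * u + (changeLine m l).2 = v) :
    slopeT l.1 (slopePt m u v) = l.2 := by
  have h' : m - l.1 ≠ 0 := sub_ne_zero.2 h.symm
  have hm := hF m
  subst hl
  simp only [changeLine, slopeT, slopePt]
  field_simp
  ring

theorem changeLine_fst_injective {m m₁ m₂ t₁ t₂ : F} (h₁ : m₁ ≠ m) (h₂ : m₂ ≠ m)
    (h : (changeLine m (m₁, t₁)).1 = (changeLine m (m₂, t₂)).1) : m₁ = m₂ := by
  have h₁' : m - m₁ ≠ 0 := sub_ne_zero.2 h₁.symm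
  have h₂' : m - m₂ ≠ 0 := sub_ne_zero.2 h₂.symm
  simp only [changeLine] at h
  rw [div_eq_div_iff h₁' h₂'] at h
  apply mul_left_cancel₀ (hF m)
  linear_combination -h

variable [DecidableEq F] [Fintype F]

theorem card_changeLine_concurrent_le (E : Finset (F × F)) (i : ℕ) (m u v : F) :
    ((((dyadicLines E i).filter fun l => l.1 ≠ m).image (changeLine m)).filter
      fun l => l.1 * u + l.2 = v).card ≤
    ((dyadicLines E i).filter fun l => slopeT l.1 (slopePt m u v) = l.2).card := by
  refine (card_le_card (t := image (changeLine m) _) ?_).trans card_image_le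
  intro l hl
  obtain ⟨hl, hl'⟩ := mem_filter.1 hl
  obtain ⟨k, hk, rfl⟩ := mem_image.1 hl
  obtain ⟨hk, hkm⟩ := mem_filter.1 hk
  exact mem_image_of_mem _ (mem_filter.2 ⟨hk, slopeT_slopePt_of_changeLine hF hkm hl'⟩)

theorem card_flag_le (E : Finset (F × F)) (i j : ℕ) (m : F) (y : F × F) :
    ((E ×ˢ univ).filter fun q : (F × F) × F =>
      (m, q.1, y) ∈ oppClass E i j ∧ Nat.log 2 (rowT E q.2 q.1) = i).card ≤
    ((E.filter fun z => slopeS m z = slopeS m y).image (slopeT m)).card *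
      ((E.filter fun z => slopeT m z = slopeT m y).image (slopeS m)).card +
    ((((E.filter fun z => slopeS m z = slopeS m y).image (slopeT m)) ×ˢ
      (((dyadicLines E i).filter fun l => l.1 ≠ m).image (changeLine m))).filter fun q =>
        q.2.1 * q.1 + q.2.2 ∈ (E.filter fun z => slopeT m z = slopeT m y).image (slopeS m)).card := by
  set A := (E.filter fun z => slopeS m z = slopeS m y).image (slopeT m) with hA
  set B := (E.filter fun z => slopeT m z = slopeT m y).image (slopeS m) with hB
  set Φ := (E ×ˢ univ).filter fun q : (F × F) × F =>
      (m, q.1, y) ∈ oppClass E i j ∧ Nat.log 2 (rowT E q.2 q.1) = i with hΦ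
  have hmem : ∀ q ∈ Φ, slopeT m q.1 ∈ A ∧ slopeS m q.1 ∈ B ∧ Nat.log 2 (rowT E q.2 q.1) = i := by
    rintro ⟨x, m'⟩ hq
    obtain ⟨-, hq, hi⟩ := mem_filter.1 hq
    obtain ⟨⟨-, -, -, ⟨b, hb, hb1, hb2⟩, d, hd, hd1, hd2⟩, -⟩ := mem_oppClass.1 hq
    exact ⟨mem_image.2 ⟨b, mem_filter.2 ⟨hb, hb2⟩, hb1⟩,
      mem_image.2 ⟨d, mem_filter.2 ⟨hd, hd1⟩, hd2⟩, hi⟩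
  rw [← card_filter_add_card_filter_not (s := Φ) fun q => q.2 = m]
  refine Nat.add_le_add ?_ ?_
  · rw [← card_product]
    refine card_le_card_of_injOn (fun q => (slopeT m q.1, slopeS m q.1)) ?_ ?_
    · intro q hq
      obtain ⟨h1, h2, -⟩ := hmem q (mem_filter.1 hq).1
      exact mem_product.2 ⟨h1, h2⟩
    · intro q hq q' hq' h
      simp only [Prod.mk.injEq] at h
      exact Prod.ext (eq_of_slopes_eq hF h.1 h.2)
        ((mem_filter.1 hq).2.trans (mem_filter.1 hq').2.symm)
  · refine card_le_card_of_injOn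
      (fun q => (slopeT m q.1, changeLine m (q.2, slopeT q.2 q.1))) ?_ ?_
    · intro q hq
      obtain ⟨hq, hqm⟩ := mem_filter.1 hq
      obtain ⟨h1, h2, h3⟩ := hmem q hq
      refine mem_filter.2 ⟨mem_product.2 ⟨h1, mem_image_of_mem _ (mem_filter.2
        ⟨mem_dyadicLines.2 h3, hqm⟩)⟩, ?_⟩
      rwa [changeLine_mul_add hqm]
    · rintro ⟨x, m₁⟩ hq ⟨x', m₂⟩ hq' h
      have hm₁ := (mem_filter.1 hq).2
      have hm₂ := (mem_filter.1 hq').2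
      simp only at hm₁ hm₂ h
      obtain ⟨h1, h2⟩ := Prod.mk.inj h
      obtain rfl := changeLine_fst_injective hF hm₁ hm₂ (congrArg Prod.fst h2)
      have h3 : slopeS m x = slopeS m x' := by
        rw [← changeLine_mul_add hm₁ x, ← changeLine_mul_add hm₁ x', h1, h2]
      rw [eq_of_slopes_eq hF h1 h3]

end LineChange

/-- The main estimate in the range where the incidence bound applies. -/
theorem exists_card_oppClass_le {η : ℝ} (hη : 0 < η) (hη1 : η ≤ 1) :
    ∃ C : ℝ, 0 < C ∧ ∀ (p : ℕ) [Fact p.Prime] (_ : p % 4 = 3) (E : Finset (ZMod p × ZMod p))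
      (i j : ℕ), i ≠ 0 → j ≤ i → (2 ^ i) ^ 3 ≤ 2 * E.card ^ 2 → 8 * E.card ^ 2 ≤ 2 ^ i * p ^ 2 →
      ((oppClass E i j).card : ℝ) ≤ E.card * (4 * (2 ^ i) ^ 2 +
        √(2 * 2 ^ i * (C * (8 * (E.card : ℝ) ^ 2 / 2 ^ i) ^ (3 / 2 + η)))) := by
  obtain ⟨C, hC, h⟩ := exists_cartesian_incidence_bound hη hη1
  refine ⟨C, hC, fun p _ hp E i j hi hji hK hKp => ?_⟩
  have hF := one_add_sq_ne_zero_of_mod_four hp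
  refine card_le_card_mul_of_flags (oppClass E i j) E (fun m x => Nat.log 2 (rowT E m x) = i)
    ?_ ?_ (by positivity) fun m y => ?_
  · intro m x y hq
    obtain ⟨⟨⟨hm, hx, hy⟩, ho⟩, ⟨h1, h2⟩, h3, h4⟩ := mem_oppClass.1 hq
    exact mem_oppClass.2 ⟨⟨⟨hm, hy, hx⟩, ho.symm⟩, ⟨h2, h1⟩, h4, h3⟩
  · intro m x y hq
    obtain ⟨⟨⟨hm, hx, hy⟩, ho⟩, ⟨h1, h2⟩, h3, h4⟩ := mem_oppClass.1 hq
    exact ⟨hy, h2⟩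
  have hflag := card_flag_le hF E i j m y
  set Φ := (E ×ˢ univ).filter fun q : (ZMod p × ZMod p) × ZMod p =>
      (m, q.1, y) ∈ oppClass E i j ∧ Nat.log 2 (rowT E q.2 q.1) = i with hΦ
  set A := (E.filter fun z => slopeS m z = slopeS m y).image (slopeT m) with hA
  set B := (E.filter fun z => slopeT m z = slopeT m y).image (slopeS m) with hB
  set L := ((dyadicLines E i).filter fun l => l.1 ≠ m).image (changeLine m) with hL
  rcases Φ.eq_empty_or_nonempty with h0 | ⟨q, hq⟩
  · rw [h0, card_empty, Nat.cast_zero]; positivity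
  have hq := (mem_filter.1 hq).2.1
  obtain ⟨-, ⟨-, hyT⟩, -, hyS⟩ := mem_oppClass.1 hq
  have hBc : B.card ≤ 2 * 2 ^ i := card_image_le.trans (le_two_mul_two_pow_of_log_eq hyT)
  have hAc : A.card ≤ 2 * 2 ^ i := (card_image_le.trans (le_two_mul_two_pow_of_log_eq hyS)).trans
    (by gcongr; norm_num)
  have hLc : L.card * (2 ^ i) ^ 2 ≤ 2 * E.card ^ 2 := le_trans
    (Nat.mul_le_mul_right _ (card_image_le.trans (card_filter_le _ _))) (card_dyadicLines_mul_le hF E hi)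
  have hpos : 0 < 2 ^ i := by positivity
  have hinc := h p A B L (8 * E.card ^ 2 / 2 ^ i) (2 * E.card / 2 ^ i) (by
      rw [Nat.le_div_iff_mul_le hpos]
      calc _ ≤ 2 * (2 * 2 ^ i * L.card) * 2 ^ i := by gcongr
        _ = 4 * (L.card * (2 ^ i) ^ 2) := by ring
        _ ≤ 4 * (2 * E.card ^ 2) := by gcongr
        _ = _ := by ring) (Nat.div_le_of_le_mul hKp) (by
      rw [Nat.le_div_iff_mul_le hpos]
      calc _ ≤ (2 * 2 ^ i) ^ 2 * 2 ^ i := by gcongr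
        _ = 4 * (2 ^ i) ^ 3 := by ring
        _ ≤ 4 * (2 * E.card ^ 2) := by gcongr
        _ = _ := by ring) (by
      rw [Nat.le_div_iff_mul_le hpos]
      have h1 : 2 * E.card / 2 ^ i * 2 ^ i ≤ 2 * E.card := Nat.div_mul_le_self _ _
      calc _ ≤ (2 * E.card / 2 ^ i) ^ 2 * (2 ^ i) ^ 2 :=
              Nat.mul_le_mul_left _ (Nat.le_self_pow two_ne_zero _)
        _ = (2 * E.card / 2 ^ i * 2 ^ i) ^ 2 := by ring
        _ ≤ (2 * E.card) ^ 2 := by gcongr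
        _ ≤ _ := by nlinarith) (fun u v => by
      rw [Nat.le_div_iff_mul_le hpos]
      exact (Nat.mul_le_mul_right _ (card_changeLine_concurrent_le hF E i m u v)).trans
        (card_dyadicLines_through_mul_le hF E hi (slopePt m u v)))
  have hinc2 := Real.le_sqrt_of_sq_le hinc
  have hN : ((8 * E.card ^ 2 / 2 ^ i : ℕ) : ℝ) ≤ 8 * (E.card : ℝ) ^ 2 / 2 ^ i := by
    refine Nat.cast_div_le.trans (le_of_eq ?_)
    push_cast; ring
  have hBr : (B.card : ℝ) ≤ 2 * 2 ^ i := by exact_mod_cast hBc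
  have hAB : A.card * B.card ≤ 4 * (2 ^ i) ^ 2 := by
    calc _ ≤ (2 * 2 ^ i) * (2 * 2 ^ i) := by gcongr
      _ = _ := by ring
  calc (Φ.card : ℝ) ≤ (A.card * B.card : ℕ) +
        (((A ×ˢ L).filter fun q => q.2.1 * q.1 + q.2.2 ∈ B).card : ℝ) := by exact_mod_cast hflag
    _ ≤ _ := by
      gcongr
      · exact_mod_cast hAB
      · exact hinc2.trans (by gcongr)

theorem mul_sqrt_le_rpow {C n K : ℝ} (hC : 0 < C) (hn : 1 ≤ n)
    (hK : n ^ (17 / 41 - 1 / 100 : ℝ) ≤ K) :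
    n * √(2 * K * (C * (8 * n ^ 2 / K) ^ (3 / 2 + 1 / 200 : ℝ))) ≤
      √(2 * C * 8 ^ (3 / 2 + 1 / 200 : ℝ)) * n ^ (99 / 41 - 1 / 100 : ℝ) := by
  have hn0 : 0 < n := by linarith
  have hK1 : 1 ≤ K := (Real.one_le_rpow hn (by norm_num)).trans hK
  have hK0 : 0 < K := by linarith
  set θ : ℝ := 17 / 41 - 1 / 100 with hθ
  have h1 : K * (n ^ 2 / K) ^ (3 / 2 + 1 / 200 : ℝ) ≤
      n ^ (2 * (3 / 2 + 1 / 200) - θ * (1 / 2 + 1 / 200) : ℝ) := by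
    rw [Real.div_rpow (by positivity) hK0.le, ← Real.rpow_natCast n 2, ← Real.rpow_mul hn0.le,
      Real.rpow_sub hn0, Real.rpow_mul hn0.le θ, mul_div_assoc',
      show (3 / 2 + 1 / 200 : ℝ) = 1 + (1 / 2 + 1 / 200) by ring, Real.rpow_add hK0, Real.rpow_one,
      mul_div_mul_left _ _ hK0.ne']
    push_cast
    gcongr
  have h2 : 2 * K * (C * (8 * n ^ 2 / K) ^ (3 / 2 + 1 / 200 : ℝ)) =
      2 * C * 8 ^ (3 / 2 + 1 / 200 : ℝ) * (K * (n ^ 2 / K) ^ (3 / 2 + 1 / 200 : ℝ)) := by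
    rw [mul_div_assoc, Real.mul_rpow (by norm_num) (by positivity)]
    ring
  rw [h2, Real.sqrt_mul (by positivity), mul_left_comm]
  gcongr
  calc n * √(K * (n ^ 2 / K) ^ (3 / 2 + 1 / 200 : ℝ))
      ≤ n ^ (1 : ℝ) * √(n ^ (2 * (3 / 2 + 1 / 200) - θ * (1 / 2 + 1 / 200) : ℝ)) := by
        rw [Real.rpow_one]
        gcongr
    _ = n ^ (1 + (2 * (3 / 2 + 1 / 200) - θ * (1 / 2 + 1 / 200)) * (1 / 2) : ℝ) := by
        rw [Real.sqrt_eq_rpow, ← Real.rpow_mul hn0.le, ← Real.rpow_add hn0]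
    _ ≤ _ := Real.rpow_le_rpow_of_exponent_le hn (by rw [hθ]; norm_num)

theorem exists_card_oppClass_le_rpow : ∃ C : ℝ, 0 < C ∧ ∀ (p : ℕ) [Fact p.Prime] (_ : p % 4 = 3)
    (E : Finset (ZMod p × ZMod p)), E.Nonempty →
    (E.card : ℝ) ≤ 1 / 8 * (p : ℝ) ^ (26 / 21 : ℝ) → ∀ i j : ℕ, j ≤ i →
    ((oppClass E i j).card : ℝ) ≤ C * (E.card : ℝ) ^ (99 / 41 - 1 / 100 : ℝ) := by
  obtain ⟨C, hC, h⟩ := exists_card_oppClass_le (η := 1 / 200) (by norm_num) (by norm_num)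
  refine ⟨16 + √(2 * C * 8 ^ (3 / 2 + 1 / 200 : ℝ)), by positivity,
    fun p _ hp E hE hEp i j hji => ?_⟩
  have hF := one_add_sq_ne_zero_of_mod_four hp
  have hn : (1 : ℝ) ≤ E.card := by exact_mod_cast hE.card_pos
  have hP := card_oppClass_le_of_poor hF E i j
  obtain ⟨n, hnE⟩ : ∃ n : ℝ, n = E.card := ⟨_, rfl⟩
  obtain ⟨K, hKi⟩ : ∃ K : ℝ, K = 2 ^ i := ⟨_, rfl⟩
  have hK0 : 0 < K := hKi ▸ by positivity
  have hP' : ((oppClass E i j).card : ℝ) ≤ n ^ 2 * (2 * K) := by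
    rw [hnE, hKi]; exact_mod_cast hP
  rw [← hnE] at hn hEp ⊢
  have hn0 : 0 < n := by linarith
  have hs := Real.sqrt_nonneg (2 * C * 8 ^ (3 / 2 + 1 / 200 : ℝ))
  have h73 : n ^ (7 / 3 : ℝ) ≤ n ^ (99 / 41 - 1 / 100 : ℝ) :=
    Real.rpow_le_rpow_of_exponent_le hn (by norm_num)
  have hpos : 0 < n ^ (99 / 41 - 1 / 100 : ℝ) := by positivity
  rcases le_total K (n ^ (17 / 41 - 1 / 100 : ℝ)) with hK | hK
  · calc ((oppClass E i j).card : ℝ) ≤ n ^ 2 * (2 * K) := hP'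
      _ ≤ n ^ (2 : ℝ) * (2 * n ^ (17 / 41 - 1 / 100 : ℝ)) := by
        rw [Real.rpow_two]; gcongr
      _ = 2 * n ^ (99 / 41 - 1 / 100 : ℝ) := by
        rw [mul_left_comm, ← Real.rpow_add hn0]; norm_num
      _ ≤ _ := by gcongr; linarith
  rcases eq_or_ne i 0 with rfl | hi
  · calc ((oppClass E 0 j).card : ℝ) ≤ n ^ 2 * (2 * K) := hP'
      _ = 2 * n ^ (2 : ℝ) := by rw [hKi, Real.rpow_two]; ring
      _ ≤ 2 * n ^ (99 / 41 - 1 / 100 : ℝ) := by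
        gcongr
        norm_num
      _ ≤ _ := by gcongr; linarith
  have h23 : (n ^ (2 / 3 : ℝ)) ^ 3 = n ^ 2 := by
    rw [← Real.rpow_natCast, ← Real.rpow_mul hn0.le, ← Real.rpow_natCast]; norm_num
  by_cases hK3 : (2 ^ i) ^ 3 ≤ 2 * E.card ^ 2
  · have hp2 : (8 * n) ^ (21 / 13 : ℝ) ≤ (p : ℝ) ^ 2 := by
      calc (8 * n) ^ (21 / 13 : ℝ) ≤ ((p : ℝ) ^ (26 / 21 : ℝ)) ^ (21 / 13 : ℝ) := by
            gcongr; linarith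
        _ = (p : ℝ) ^ 2 := by
            rw [← Real.rpow_mul (by positivity), ← Real.rpow_natCast]; norm_num
    have h8 : 8 * n ^ 2 ≤ K * (p : ℝ) ^ 2 := by
      calc 8 * n ^ 2 ≤ 8 * n ^ (17 / 41 - 1 / 100 + 21 / 13 : ℝ) := by
            rw [← Real.rpow_natCast n 2]
            gcongr
            norm_num
        _ = n ^ (17 / 41 - 1 / 100 : ℝ) * (8 ^ (1 : ℝ) * n ^ (21 / 13 : ℝ)) := by
            rw [Real.rpow_add hn0, Real.rpow_one]; ring
        _ ≤ n ^ (17 / 41 - 1 / 100 : ℝ) * (8 ^ (21 / 13 : ℝ) * n ^ (21 / 13 : ℝ)) := by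
            gcongr <;> norm_num
        _ = n ^ (17 / 41 - 1 / 100 : ℝ) * (8 * n) ^ (21 / 13 : ℝ) := by
            rw [Real.mul_rpow (by norm_num) hn0.le]
        _ ≤ K * (p : ℝ) ^ 2 := by gcongr
    have h1 := h p hp E i j hi hji hK3 (by rw [hnE, hKi] at h8; exact_mod_cast h8)
    rw [← hnE, ← hKi, mul_add] at h1
    have hK3' : K ^ 3 ≤ (2 * n ^ (2 / 3 : ℝ)) ^ 3 := by
      have h3 : K ^ 3 ≤ 2 * n ^ 2 := by rw [hKi, hnE]; exact_mod_cast hK3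
      rw [mul_pow, h23]
      nlinarith
    have hK2 : K ≤ 2 * n ^ (2 / 3 : ℝ) := le_of_pow_le_pow_left₀ three_ne_zero (by positivity) hK3'
    have h2 : n * (4 * K ^ 2) ≤ 16 * n ^ (7 / 3 : ℝ) := by
      calc n * (4 * K ^ 2) ≤ n * (4 * (2 * n ^ (2 / 3 : ℝ)) ^ 2) := by gcongr
        _ = 16 * (n ^ (1 : ℝ) * (n ^ (2 / 3 : ℝ) * n ^ (2 / 3 : ℝ))) := by
          rw [Real.rpow_one]; ring
        _ = _ := by rw [← Real.rpow_add hn0, ← Real.rpow_add hn0]; norm_num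
    have h3 := mul_sqrt_le_rpow hC hn hK
    rw [add_mul]
    linarith
  · have h1 := card_oppClass_mul_le_of_rich hF E hi j
    have h1' : ((oppClass E i j).card : ℝ) * K ≤ 4 * n ^ 3 := by
      rw [hnE, hKi]; exact_mod_cast h1
    have hK3' : (n ^ (2 / 3 : ℝ)) ^ 3 ≤ K ^ 3 := by
      have h3 : 2 * n ^ 2 ≤ K ^ 3 := by rw [hKi, hnE]; exact_mod_cast (not_le.1 hK3).le
      rw [h23]
      nlinarith
    have hK2 : n ^ (2 / 3 : ℝ) ≤ K := le_of_pow_le_pow_left₀ three_ne_zero hK0.le hK3'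
    have h2 : ((oppClass E i j).card : ℝ) ≤ 4 * n ^ (7 / 3 : ℝ) := by
      have h4 : n ^ 3 = n ^ (7 / 3 : ℝ) * n ^ (2 / 3 : ℝ) := by
        rw [← Real.rpow_add hn0, ← Real.rpow_natCast]; norm_num
      refine le_of_mul_le_mul_right ?_ (show 0 < n ^ (2 / 3 : ℝ) by positivity)
      calc _ ≤ ((oppClass E i j).card : ℝ) * K := by gcongr
        _ ≤ 4 * n ^ 3 := h1'
        _ = _ := by rw [h4]; ring
    calc _ ≤ 4 * n ^ (99 / 41 - 1 / 100 : ℝ) := by linarith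
      _ ≤ _ := by gcongr; linarith

theorem exists_log_add_one_le_rpow {δ : ℝ} (hδ : 0 < δ) :
    ∃ C : ℝ, 0 < C ∧ ∀ n : ℕ, 1 ≤ n → (Nat.log 2 n : ℝ) + 1 ≤ C * (n : ℝ) ^ δ := by
  have h2 : 0 < Real.log 2 := Real.log_pos (by norm_num)
  refine ⟨1 / δ / Real.log 2 + 1, by positivity, fun n hn => ?_⟩
  have hn' : (1 : ℝ) ≤ n := by exact_mod_cast hn
  have h1 : (Nat.log 2 n : ℝ) ≤ Real.log n / Real.log 2 := by
    have := Real.natLog_le_logb n 2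
    simpa [Real.logb] using this
  have h3 : Real.log n ≤ (n : ℝ) ^ δ / δ := Real.log_le_rpow_div (by positivity) hδ
  have h4 : 1 ≤ (n : ℝ) ^ δ := Real.one_le_rpow hn' hδ.le
  calc (Nat.log 2 n : ℝ) + 1 ≤ (n : ℝ) ^ δ / δ / Real.log 2 + (n : ℝ) ^ δ := by
        gcongr; exact h1.trans (by gcongr)
    _ = _ := by ring

/-- (Lewko) For every `ε > 0` there exist `C_ε > 0` and `c > 0` such that for every prime
`p ≡ 3 (mod 4)` and every `E ⊆ 𝔽_p²` with `|E| ≤ c·p^{26/21}`,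
`□(E) ≤ C_ε·p^ε·|E|^{99/41}`. -/
theorem lewko_rectangle_bound (ε : ℝ) (hε : 0 < ε) :
    ∃ Cε c : ℝ, 0 < Cε ∧ 0 < c ∧
      ∀ (p : ℕ) [Fact p.Prime], p % 4 = 3 →
        ∀ E : Finset (Pt p), (E.card : ℝ) ≤ c * (p : ℝ) ^ ((26 : ℝ) / 21) →
          (rectCount p E : ℝ) ≤ Cε * (p : ℝ) ^ ε * (E.card : ℝ) ^ ((99 : ℝ) / 41) := by
  obtain ⟨C, hC, h⟩ := exists_card_oppClass_le_rpow
  obtain ⟨D, hD, hlog⟩ := exists_log_add_one_le_rpow (δ := 1 / 400) (by norm_num)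
  refine ⟨(4 + C) * D ^ 4, 1 / 8, by positivity, by norm_num, fun p _ hp E hEp => ?_⟩
  have hF := one_add_sq_ne_zero_of_mod_four hp
  have hrect := rectCount_le hF E
  have hopp := card_oppSet_le hF E
  rcases E.eq_empty_or_nonempty with rfl | hE
  · have h0 : oppSet (∅ : Finset (ZMod p × ZMod p)) = ∅ := by simp [oppSet]
    rw [h0] at hrect
    have : rectCount p ∅ = 0 := by simpa using hrect
    rw [this, Nat.cast_zero]
    positivity
  have hn : (1 : ℝ) ≤ E.card := by exact_mod_cast hE.card_pos
  have hp1 : 1 ≤ (p : ℝ) ^ ε :=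
    Real.one_le_rpow (by exact_mod_cast (Fact.out : p.Prime).one_le) hε.le
  have hclass : ∀ i j, ((oppClass E i j).card : ℝ) ≤ C * (E.card : ℝ) ^ (99 / 41 - 1 / 100 : ℝ) := by
    intro i j
    rcases le_total j i with hij | hij
    · exact h p hp E hE hEp i j hij
    · exact le_trans (by exact_mod_cast card_oppClass_swap_le E i j) (h p hp E hE hEp j i hij)
  have hI := hlog E.card hE.card_pos
  have hrect' : (rectCount p E : ℝ) ≤ 2 * (E.card : ℝ) ^ 2 + (oppSet E).card := by
    exact_mod_cast hrect
  have hopp' : ((oppSet E).card : ℝ) ≤ ((Nat.log 2 E.card : ℝ) + 1) * ((E.card : ℝ) ^ 2 +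
      ((Nat.log 2 E.card : ℝ) + 1) * ((E.card : ℝ) ^ 2 + ∑ i ∈ range (Nat.log 2 E.card + 1),
        ∑ j ∈ range (Nat.log 2 E.card + 1), ((oppClass E i j).card : ℝ))) := by
    exact_mod_cast hopp
  have hsum : ∑ i ∈ range (Nat.log 2 E.card + 1), ∑ j ∈ range (Nat.log 2 E.card + 1),
      ((oppClass E i j).card : ℝ) ≤ ((Nat.log 2 E.card : ℝ) + 1) ^ 2 *
        (C * (E.card : ℝ) ^ (99 / 41 - 1 / 100 : ℝ)) := by
    refine (sum_le_sum fun i _ => sum_le_sum fun j _ => hclass i j).trans (le_of_eq ?_)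
    simp only [sum_const, card_range, nsmul_eq_mul]
    push_cast
    ring
  have hJ : (1 : ℝ) ≤ (Nat.log 2 E.card : ℝ) + 1 := by
    have : (0 : ℝ) ≤ Nat.log 2 E.card := Nat.cast_nonneg _
    linarith
  generalize (Nat.log 2 E.card : ℝ) + 1 = J at hI hopp' hsum hJ
  set n : ℝ := (E.card : ℝ) with hnE
  set X : ℝ := n ^ (99 / 41 - 1 / 100 : ℝ) with hX
  have hn0 : 0 < n := by linarith
  have hX0 : 0 < X := by positivity
  have hn2 : n ^ 2 ≤ X := by
    rw [← Real.rpow_natCast n 2]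
    exact Real.rpow_le_rpow_of_exponent_le hn (by norm_num)
  have hJ4 : J ^ 4 ≤ D ^ 4 * n ^ (1 / 100 : ℝ) := by
    calc J ^ 4 ≤ (D * n ^ (1 / 400 : ℝ)) ^ 4 := by gcongr
      _ = D ^ 4 * n ^ (1 / 100 : ℝ) := by
        rw [mul_pow, ← Real.rpow_natCast (n ^ (1 / 400 : ℝ)), ← Real.rpow_mul hn0.le]; norm_num
  have hJ1 : J ≤ J ^ 4 := le_self_pow₀ hJ (by norm_num)
  have hJ2 : J ^ 2 ≤ J ^ 4 := pow_le_pow_right₀ hJ (by norm_num)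
  have hmain : (rectCount p E : ℝ) ≤ (4 + C) * J ^ 4 * X := by
    calc (rectCount p E : ℝ) ≤ 2 * X + J * (X + J * (X + J ^ 2 * (C * X))) := by
          refine hrect'.trans (add_le_add (by gcongr) (hopp'.trans ?_))
          gcongr
      _ = (2 + J + J ^ 2 + C * J ^ 4) * X := by ring
      _ ≤ (2 * J ^ 4 + J ^ 4 + J ^ 4 + C * J ^ 4) * X := by gcongr; linarith
      _ = _ := by ring
  calc (rectCount p E : ℝ) ≤ (4 + C) * J ^ 4 * X := hmain
    _ ≤ (4 + C) * (D ^ 4 * n ^ (1 / 100 : ℝ)) * X := by gcongr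
    _ = (4 + C) * D ^ 4 * 1 * n ^ (99 / 41 : ℝ) := by
      have h3 : n ^ (1 / 100 : ℝ) * X = n ^ (99 / 41 : ℝ) := by
        rw [hX, ← Real.rpow_add hn0]; norm_num
      rw [← h3]; ring
    _ ≤ (4 + C) * D ^ 4 * (p : ℝ) ^ ε * n ^ (99 / 41 : ℝ) := by gcongr

end FpDist
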